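/- arXiv:2110.14912 — 2 statements merged into one kernel-verified Lean document; each statement's English description precedes it below -/
import Mathlib

section
/- Let k ≥ 1 be a natural number. There exists a constant C > 0 such that for every Schwartz function u : ℝ² → ℂ one has C⁻¹ ( ‖Δᵏ u‖²_{L²} + ‖⟨x⟩^{2k} u‖²_{L²} ) ≤ ‖Aᵏ u‖²_{L²} ≤ C ( ‖Δᵏ u‖²_{L²} + ‖⟨x⟩^{2k} u‖²_{L²} ), where Aᵏ denotes the k-fold application of A. -/
open MeasureTheory Complex

noncomputable section

abbrev E2 : Type := EuclideanSpace ℝ (Fin 2)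

/-- Partial derivative in the `i`-th coordinate direction. -/
noncomputable def pd (i : Fin 2) (f : E2 → ℂ) : E2 → ℂ :=
  fun x => fderiv ℝ f x (EuclideanSpace.single i 1)

/-- The Laplacian on `ℝ²`. -/
noncomputable def lap (f : E2 → ℂ) : E2 → ℂ :=
  fun x => ∑ i : Fin 2, pd i (pd i f) x

/-- The harmonic oscillator `A f = -Δ f + |x|² f`. -/
noncomputable def Aop (f : E2 → ℂ) : E2 → ℂ :=
  fun x => -lap f x + (‖x‖ : ℂ)^2 * f x

/-- Time derivative of a time-dependent function. -/
noncomputable def tderiv (F : ℝ → E2 → ℂ) : ℝ → E2 → ℂ :=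
  fun t x => deriv (fun s => F s x) t

/-- Squared euclidean norm of the gradient, `|∇f|²(x)`. -/
noncomputable def gradSq (f : E2 → ℂ) (x : E2) : ℝ := ∑ i : Fin 2, ‖pd i f x‖^2

/-- The `L²` norm. -/
noncomputable def L2norm (f : E2 → ℂ) : ℝ := Real.sqrt (∫ x : E2, ‖f x‖^2)

/-- The `ℋ¹` norm: `(‖∇φ‖² + ‖|x|φ‖²)^(1/2)`. -/
noncomputable def H1norm (f : E2 → ℂ) : ℝ :=
  Real.sqrt ((∫ x : E2, gradSq f x) + ∫ x : E2, ‖x‖^2 * ‖f x‖^2)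

/-- A Schwartz-regular solution of the cubic NLS with harmonic potential,
`i ∂ₜ u - Δu + |x|² u + σ u |u|² = 0`. -/
def IsSolution (σ : ℝ) (u : ℝ → SchwartzMap E2 ℂ) : Prop :=
  ContDiff ℝ (⊤ : ℕ∞) (fun p : ℝ × E2 => u p.1 p.2) ∧
  ∀ (t : ℝ) (x : E2), Complex.I * deriv (fun s => u s x) t - lap (fun y => u t y) x
    + (‖x‖ : ℂ)^2 * u t x + (σ : ℂ) * u t x * (‖u t x‖ : ℂ)^2 = 0

/-- A Schwartz-regular solution of the linear Schrödinger equation with harmonic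
potential, `i ∂ₜ w - Δw + |x|² w = 0`. -/
def IsLinSolution (w : ℝ → SchwartzMap E2 ℂ) : Prop :=
  ContDiff ℝ (⊤ : ℕ∞) (fun p : ℝ × E2 => w p.1 p.2) ∧
  ∀ (t : ℝ) (x : E2), Complex.I * deriv (fun s => w s x) t - lap (fun y => w t y) x
    + (‖x‖ : ℂ)^2 * w t x = 0

/-- Partial derivative for real-valued functions. -/
noncomputable def pdR (i : Fin 2) (f : E2 → ℝ) : E2 → ℝ :=
  fun x => fderiv ℝ f x (EuclideanSpace.single i 1)

/-- The Laplacian for real-valued functions. -/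
noncomputable def lapR (f : E2 → ℝ) : E2 → ℝ :=
  fun x => ∑ i : Fin 2, pdR i (pdR i f) x

/-- The operators `T` with `‖N (T u)‖ ≤ C * q u` for some constant `C`. -/
def dominatedBy {E H : Type*} [AddCommGroup E] [Module ℝ E] [NormedAddCommGroup H]
    [InnerProductSpace ℝ H] (N : E →ₗ[ℝ] H) (q : E → ℝ) : Submodule ℝ (Module.End ℝ E) where
  carrier := {T | ∃ C, 0 ≤ C ∧ ∀ u, ‖N (T u)‖ ≤ C * q u}
  zero_mem' := ⟨0, le_rfl, by simp⟩
  add_mem' := by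
    rintro S T ⟨C, hC, hS⟩ ⟨D, hD, hT⟩
    refine ⟨C + D, by positivity, fun u => ?_⟩
    rw [LinearMap.add_apply, map_add, add_mul]
    exact (norm_add_le _ _).trans (add_le_add (hS u) (hT u))
  smul_mem' := by
    rintro c T ⟨C, hC, hT⟩
    refine ⟨|c| * C, by positivity, fun u => ?_⟩
    rw [LinearMap.smul_apply, map_smul, norm_smul, Real.norm_eq_abs, mul_assoc]
    exact mul_le_mul_of_nonneg_left (hT u) (abs_nonneg c)

/-- Operators `x i`, `d i` satisfying the canonical commutation relations, where `x i` is symmetric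
and `d i` antisymmetric for the inner product pulled back along `N`. -/
structure IsCanonicalPair {ι E H : Type*} [DecidableEq ι] [AddCommGroup E] [Module ℝ E]
    [NormedAddCommGroup H] [InnerProductSpace ℝ H] (N : E →ₗ[ℝ] H)
    (x d : ι → Module.End ℝ E) : Prop where
  x_symm : ∀ i u v, inner ℝ (N (x i u)) (N v) = inner ℝ (N u) (N (x i v))
  d_symm : ∀ i u v, inner ℝ (N (d i u)) (N v) = -inner ℝ (N u) (N (d i v))
  x_comm : ∀ i j, x i * x j = x j * x i
  d_comm : ∀ i j, d i * d j = d j * d i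
  comm : ∀ i j, d i * x j - x j * d i = if i = j then 1 else 0

section WeylAlgebra

variable {ι E : Type*} [AddCommGroup E] [Module ℝ E]

/-- The span of `1`, the `x i` and the `d i`. -/
def weylSpan (x d : ι → Module.End ℝ E) : Submodule ℝ (Module.End ℝ E) :=
  Submodule.span ℝ ({1} ∪ Set.range x ∪ Set.range d)

/-- The sum of squares of a family of operators. -/
def sumSq [Fintype ι] (x : ι → Module.End ℝ E) : Module.End ℝ E := ∑ i, x i * x i

/-- The abstract harmonic oscillator `-∑ dᵢ² + ∑ xᵢ²`. -/
def oscillator [Fintype ι] (x d : ι → Module.End ℝ E) : Module.End ℝ E := -sumSq d + sumSq x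

variable {x d : ι → Module.End ℝ E}

theorem one_le_weylSpan : (1 : Submodule ℝ (Module.End ℝ E)) ≤ weylSpan x d := by
  rw [Submodule.one_le]
  exact Submodule.subset_span (by simp)

theorem x_mem_weylSpan (i : ι) : x i ∈ weylSpan x d := Submodule.subset_span (by simp)

theorem d_mem_weylSpan (i : ι) : d i ∈ weylSpan x d := Submodule.subset_span (by simp)

theorem weylSpan_pow_add (m n : ℕ) :
    weylSpan x d ^ (m + n) = weylSpan x d ^ m * weylSpan x d ^ n := by
  rcases eq_or_ne n 0 with rfl | hn
  · rw [Submodule.pow_zero, Submodule.mul_one, add_zero]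
  · exact Submodule.pow_add _ hn

theorem mul_mem_weylSpan_pow {S T : Module.End ℝ E} {m n : ℕ} (hS : S ∈ weylSpan x d ^ m)
    (hT : T ∈ weylSpan x d ^ n) : S * T ∈ weylSpan x d ^ (m + n) := by
  rw [weylSpan_pow_add]
  exact Submodule.mul_mem_mul hS hT

theorem pow_mem_weylSpan_pow {S : Module.End ℝ E} {m : ℕ} (hS : S ∈ weylSpan x d ^ m) (n : ℕ) :
    S ^ n ∈ weylSpan x d ^ (m * n) := by
  induction n with
  | zero =>
    rw [pow_zero, mul_zero, Submodule.pow_zero]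
    exact Submodule.one_le.1 le_rfl
  | succ n ih =>
    rw [pow_succ, mul_add, mul_one]
    exact mul_mem_weylSpan_pow ih hS

variable [Fintype ι]

theorem sumSq_x_mem : sumSq x ∈ weylSpan x d ^ 2 := by
  refine Submodule.sum_mem _ fun i _ => mul_mem_weylSpan_pow (m := 1) (n := 1) ?_ ?_ <;>
    rw [Submodule.pow_one]
  exacts [x_mem_weylSpan i, x_mem_weylSpan i]

theorem sumSq_d_mem : sumSq d ∈ weylSpan x d ^ 2 := by
  refine Submodule.sum_mem _ fun i _ => mul_mem_weylSpan_pow (m := 1) (n := 1) ?_ ?_ <;>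
    rw [Submodule.pow_one]
  exacts [d_mem_weylSpan i, d_mem_weylSpan i]

theorem oscillator_mem : oscillator x d ∈ weylSpan x d ^ 2 :=
  add_mem (neg_mem sumSq_d_mem) sumSq_x_mem

end WeylAlgebra

/-- An approximately convex sequence is controlled by its endpoints. -/
theorem le_add_of_approx_convex {a : ℕ → ℝ} {e : ℝ} (n : ℕ) (ha : ∀ j, 0 ≤ a j)
    (h : ∀ j, j + 2 ≤ n → a (j + 1) ≤ (a j + a (j + 2)) / 2 + e) {j : ℕ} (hj : j ≤ n) :
    a j ≤ a 0 + a n + e * n ^ 2 - e * j ^ 2 ∨ a j ≤ a 0 - e * j ^ 2 := by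
  set b : ℕ → ℝ := fun j => a j + e * j ^ 2 with hb
  have hconv : ∀ j, j + 2 ≤ n → b (j + 1) ≤ (b j + b (j + 2)) / 2 := by
    intro j hj
    have := h j hj
    simp only [hb]
    push_cast
    linarith
  have hup : ∀ j, j + 1 ≤ n → b j ≤ max (b 0) (b (j + 1)) := by
    intro j
    induction j with
    | zero => intro _; exact le_max_left _ _
    | succ j ih =>
      intro hj
      have h1 := ih (by omega)
      have h2 := hconv j hj
      rcases le_max_iff.1 h1 with h3 | h3
      · by_contra! hc
        have := max_lt_iff.1 hc
        linarith
      · exact le_max_of_le_right (by simp only [add_assoc] at *; norm_num at *; linarith)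
  have hall : ∀ m, j + m ≤ n → b j ≤ max (b 0) (b (j + m)) := by
    intro m
    induction m with
    | zero => intro _; exact le_max_right _ _
    | succ m ih =>
      intro hm
      refine (ih (by omega)).trans (max_le (le_max_left _ _) ?_)
      exact hup (j + m) (by omega)
  have := hall (n - j) (by omega)
  rw [Nat.add_sub_cancel' hj] at this
  have h0 := ha 0
  rcases le_max_iff.1 this with h1 | h1
  · right; simp only [hb] at h1; norm_num at h1; linarith
  · left; simp only [hb] at h1; linarith

namespace IsCanonicalPair

variable {ι E H : Type*} [DecidableEq ι] [AddCommGroup E] [Module ℝ E]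
  [NormedAddCommGroup H] [InnerProductSpace ℝ H] {N : E →ₗ[ℝ] H} {x d : ι → Module.End ℝ E}

theorem commutator_mem_one (hxd : IsCanonicalPair N x d) {S T : Module.End ℝ E}
    (hS : S ∈ weylSpan x d) (hT : T ∈ weylSpan x d) :
    S * T - T * S ∈ (1 : Submodule ℝ (Module.End ℝ E)) := by
  have h1 : (1 : Module.End ℝ E) ∈ (1 : Submodule ℝ (Module.End ℝ E)) := Submodule.one_le.1 le_rfl
  have hdx : ∀ i j, d i * x j - x j * d i ∈ (1 : Submodule ℝ (Module.End ℝ E)) := by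
    intro i j
    rw [hxd.comm]
    split_ifs
    · exact h1
    · exact zero_mem _
  refine Submodule.span_induction₂ (p := fun S T _ _ =>
    S * T - T * S ∈ (1 : Submodule ℝ (Module.End ℝ E))) ?_ ?_ ?_ ?_ ?_ ?_ ?_ hS hT
  · rintro S T ((rfl | ⟨i, rfl⟩) | ⟨i, rfl⟩) ((rfl | ⟨j, rfl⟩) | ⟨j, rfl⟩)
    · simp only [sub_self, zero_mem]
    · simp only [one_mul, mul_one, sub_self, zero_mem]
    · simp only [one_mul, mul_one, sub_self, zero_mem]
    · simp only [one_mul, mul_one, sub_self, zero_mem]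
    · simp only [hxd.x_comm i j, sub_self, zero_mem]
    · rw [← neg_sub]; exact neg_mem (hdx j i)
    · simp only [one_mul, mul_one, sub_self, zero_mem]
    · exact hdx i j
    · simp only [hxd.d_comm i j, sub_self, zero_mem]
  · intro T _
    simp only [zero_mul, mul_zero, sub_self, zero_mem]
  · intro S _
    simp only [zero_mul, mul_zero, sub_self, zero_mem]
  · intro S S' T _ _ _ h h'
    convert add_mem h h' using 1
    noncomm_ring
  · intro S T T' _ _ _ h h'
    convert add_mem h h' using 1
    noncomm_ring
  · intro r S T _ _ h
    convert Submodule.smul_mem _ r h using 1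
    simp [smul_sub]
  · intro r S T _ _ h
    convert Submodule.smul_mem _ r h using 1
    simp [smul_sub]

theorem commutator_mem_of_mem_weylSpan (hxd : IsCanonicalPair N x d) {S : Module.End ℝ E}
    (hS : S ∈ weylSpan x d) (n : ℕ) {T : Module.End ℝ E} (hT : T ∈ weylSpan x d ^ (n + 1)) :
    S * T - T * S ∈ weylSpan x d ^ n := by
  induction n generalizing T with
  | zero =>
    rw [zero_add, Submodule.pow_one] at hT
    rw [Submodule.pow_zero]
    exact hxd.commutator_mem_one hS hT
  | succ n ih =>
    rw [Submodule.pow_succ] at hT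
    refine Submodule.mul_induction_on hT (fun T hT c hc => ?_) (fun T T' h h' => ?_)
    · have h1 := mul_mem_weylSpan_pow (ih hT) (by rwa [Submodule.pow_one] : c ∈ weylSpan x d ^ 1)
      have h2 := Submodule.mul_mem_mul hT (hxd.commutator_mem_one hS hc)
      rw [Submodule.mul_one] at h2
      convert add_mem h1 h2 using 1
      noncomm_ring
    · convert add_mem h h' using 1
      noncomm_ring

theorem commutator_mem (hxd : IsCanonicalPair N x d) {S T : Module.End ℝ E} (m n : ℕ)
    (hS : S ∈ weylSpan x d ^ (m + 1)) (hT : T ∈ weylSpan x d ^ (n + 1)) :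
    S * T - T * S ∈ weylSpan x d ^ (m + n) := by
  induction m generalizing S with
  | zero =>
    rw [zero_add, Submodule.pow_one] at hS
    rw [zero_add]
    exact hxd.commutator_mem_of_mem_weylSpan hS n hT
  | succ m ih =>
    rw [Submodule.pow_succ] at hS
    refine Submodule.mul_induction_on hS (fun S hS c hc => ?_) (fun S S' h h' => ?_)
    · have h1 := mul_mem_weylSpan_pow (ih hS) (by rwa [Submodule.pow_one] : c ∈ weylSpan x d ^ 1)
      have h2 := mul_mem_weylSpan_pow hS (hxd.commutator_mem_of_mem_weylSpan hc n hT)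
      rw [add_right_comm] at h1
      convert add_mem h1 h2 using 1
      noncomm_ring
    · convert add_mem h h' using 1
      noncomm_ring

variable [Fintype ι]

theorem inner_sumSq_x (hxd : IsCanonicalPair N x d) (u v : E) :
    inner ℝ (N (sumSq x u)) (N v) = inner ℝ (N u) (N (sumSq x v)) := by
  simp [sumSq, LinearMap.sum_apply, sum_inner, inner_sum, hxd.x_symm]

theorem inner_sumSq_d (hxd : IsCanonicalPair N x d) (u v : E) :
    inner ℝ (N (sumSq d u)) (N v) = inner ℝ (N u) (N (sumSq d v)) := by
  simp [sumSq, LinearMap.sum_apply, sum_inner, inner_sum, hxd.d_symm]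

theorem inner_oscillator (hxd : IsCanonicalPair N x d) (u v : E) :
    inner ℝ (N (oscillator x d u)) (N v) = inner ℝ (N u) (N (oscillator x d v)) := by
  simp [oscillator, inner_add_left, inner_add_right, hxd.inner_sumSq_x, hxd.inner_sumSq_d]

theorem inner_oscillator_self (hxd : IsCanonicalPair N x d) (u : E) :
    inner ℝ (N (oscillator x d u)) (N u) = ∑ i, ‖N (d i u)‖ ^ 2 + ∑ i, ‖N (x i u)‖ ^ 2 := by
  simp [oscillator, sumSq, LinearMap.sum_apply, sum_inner, inner_add_left, hxd.x_symm, hxd.d_symm]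

theorem norm_d_sq_le (hxd : IsCanonicalPair N x d) (i : ι) (u : E) :
    ‖N (d i u)‖ ^ 2 ≤ inner ℝ (N (oscillator x d u)) (N u) := by
  rw [hxd.inner_oscillator_self]
  have := Finset.single_le_sum (f := fun i => ‖N (d i u)‖ ^ 2) (fun _ _ => by positivity)
    (Finset.mem_univ i)
  have : 0 ≤ ∑ i, ‖N (x i u)‖ ^ 2 := by positivity
  linarith

theorem norm_x_sq_le (hxd : IsCanonicalPair N x d) (i : ι) (u : E) :
    ‖N (x i u)‖ ^ 2 ≤ inner ℝ (N (oscillator x d u)) (N u) := by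
  rw [hxd.inner_oscillator_self]
  have := Finset.single_le_sum (f := fun i => ‖N (x i u)‖ ^ 2) (fun _ _ => by positivity)
    (Finset.mem_univ i)
  have : 0 ≤ ∑ i, ‖N (d i u)‖ ^ 2 := by positivity
  linarith

theorem norm_oscillator_pow_le_interpolation (hxd : IsCanonicalPair N x d) (k : ℕ) {ε : ℝ}
    (hε : 0 < ε) : ∃ C, 0 ≤ C ∧ ∀ u, ‖N ((oscillator x d ^ k) u)‖
      ≤ ε * ‖N ((oscillator x d ^ (k + 1)) u)‖ + C * ‖N u‖ := by
  induction k with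
  | zero =>
    refine ⟨1, zero_le_one, fun u => ?_⟩
    have : 0 ≤ ε * ‖N ((oscillator x d ^ (0 + 1)) u)‖ := by positivity
    simpa using this
  | succ k ih =>
    obtain ⟨C, hC, h⟩ := ih
    refine ⟨C / ε, by positivity, fun u => ?_⟩
    have hu := h u
    set p := ‖N ((oscillator x d ^ k) u)‖
    set q := ‖N ((oscillator x d ^ (k + 1)) u)‖ with hq
    set r := ‖N ((oscillator x d ^ (k + 1 + 1)) u)‖ with hr
    have hqpr : q ^ 2 ≤ r * p := by
      rw [hq, ← real_inner_self_eq_norm_sq]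
      nth_rw 2 [pow_succ']
      rw [Module.End.mul_apply, ← hxd.inner_oscillator, ← Module.End.mul_apply, ← pow_succ']
      exact real_inner_le_norm _ _
    have hp : 0 ≤ p := norm_nonneg _
    have hq0 : 0 ≤ q := norm_nonneg _
    have hr0 : 0 ≤ r := norm_nonneg _
    have h2 : 2 * ε * q ≤ ε ^ 2 * r + p := by
      refine abs_le_of_sq_le_sq' ?_ (by positivity) |>.2
      nlinarith [sq_nonneg (ε ^ 2 * r - p), sq_nonneg ε,
        mul_le_mul_of_nonneg_left hqpr (sq_nonneg ε)]
    have h3 : ε * q ≤ ε * (ε * r + C / ε * ‖N u‖) := by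
      rw [mul_add, ← mul_assoc, ← mul_assoc, mul_div_cancel₀ _ hε.ne']
      nlinarith
    exact le_of_mul_le_mul_left h3 hε

theorem oscillator_pow_mem_mixed (hxd : IsCanonicalPair N x d) (k : ℕ) :
    oscillator x d ^ (k + 1) ∈
      Submodule.span ℝ {T | ∃ j l, j + l = k + 1 ∧ T = sumSq x ^ j * sumSq d ^ l}
        ⊔ weylSpan x d ^ (2 * k) := by
  induction k with
  | zero =>
    refine Submodule.mem_sup_left ?_
    have h (j l : ℕ) (hjl : j + l = 0 + 1) : sumSq x ^ j * sumSq d ^ l ∈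
        Submodule.span ℝ {T | ∃ j l, j + l = 0 + 1 ∧ T = sumSq x ^ j * sumSq d ^ l} :=
      Submodule.subset_span ⟨j, l, hjl, rfl⟩
    have h01 := h 0 1 rfl
    have h10 := h 1 0 rfl
    rw [pow_zero, pow_one, one_mul] at h01
    rw [pow_zero, pow_one, mul_one] at h10
    rw [zero_add, pow_one]
    exact add_mem (neg_mem h01) h10
  | succ k ih =>
    rw [pow_succ' _ (k + 1)]
    obtain ⟨S, hS, T, hT, hST⟩ := Submodule.mem_sup.1 ih
    rw [← hST, mul_add (oscillator x d)]
    refine Submodule.add_mem _ ?_ ?_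
    · clear hST
      refine Submodule.span_induction (p := fun S _ => oscillator x d * S ∈
        Submodule.span ℝ {T | ∃ j l, j + l = k + 1 + 1 ∧ T = sumSq x ^ j * sumSq d ^ l}
          ⊔ weylSpan x d ^ (2 * (k + 1))) ?_ ?_ ?_ ?_ hS
      · rintro _ ⟨j, l, hjl, rfl⟩
        have hcomm : (sumSq d * sumSq x ^ j - sumSq x ^ j * sumSq d) * sumSq d ^ l
            ∈ weylSpan x d ^ (2 * (k + 1)) := by
          cases j with
          | zero => simp only [pow_zero, one_mul, mul_one, sub_self, zero_mul, zero_mem]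
          | succ j =>
            have h := mul_mem_weylSpan_pow
              (hxd.commutator_mem 1 (2 * j + 1) sumSq_d_mem
                (pow_mem_weylSpan_pow sumSq_x_mem (j + 1)))
              (pow_mem_weylSpan_pow sumSq_d_mem l)
            rwa [show 1 + (2 * j + 1) + 2 * l = 2 * (k + 1) by omega] at h
        have hsplit : oscillator x d * (sumSq x ^ j * sumSq d ^ l)
            = -(sumSq x ^ j * sumSq d ^ (l + 1)) + sumSq x ^ (j + 1) * sumSq d ^ l
              - (sumSq d * sumSq x ^ j - sumSq x ^ j * sumSq d) * sumSq d ^ l := by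
          rw [oscillator, pow_succ' _ l, pow_succ' _ j]
          noncomm_ring
        rw [hsplit]
        refine sub_mem (add_mem (neg_mem ?_) ?_) (Submodule.mem_sup_right hcomm)
        · exact Submodule.mem_sup_left (Submodule.subset_span ⟨j, l + 1, by omega, rfl⟩)
        · exact Submodule.mem_sup_left (Submodule.subset_span ⟨j + 1, l, by omega, rfl⟩)
      · rw [mul_zero]
        exact zero_mem _
      · intro S S' _ _ h h'
        rw [mul_add (oscillator x d)]
        exact add_mem h h'
      · intro c S _ h
        rw [mul_smul_comm]
        exact Submodule.smul_mem _ c h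
    · apply Submodule.mem_sup_right
      rw [mul_add, mul_one, add_comm]
      exact mul_mem_weylSpan_pow oscillator_mem hT

variable [Nonempty ι]

theorem norm_sq_le (hxd : IsCanonicalPair N x d) (u : E) :
    ‖N u‖ ^ 2 ≤ inner ℝ (N (oscillator x d u)) (N u) := by
  obtain ⟨i⟩ := ‹Nonempty ι›
  have h1 : ‖N u‖ ^ 2 ≤ ‖N (d i u)‖ ^ 2 + ‖N (x i u)‖ ^ 2 := by
    have h := LinearMap.congr_fun (hxd.comm i i) u
    simp only [if_true, LinearMap.sub_apply, Module.End.mul_apply, Module.End.one_apply] at h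
    have h2 : ‖N u‖ ^ 2 = -2 * inner ℝ (N (x i u)) (N (d i u)) := by
      rw [← real_inner_self_eq_norm_sq]
      nth_rw 1 [← h]
      rw [map_sub, inner_sub_left, hxd.d_symm, hxd.x_symm i (d i u), real_inner_comm (N (x i u))]
      ring
    have h3 := norm_add_sq_real (N (x i u)) (N (d i u))
    nlinarith [sq_nonneg ‖N (x i u) + N (d i u)‖]
  refine h1.trans ?_
  rw [hxd.inner_oscillator_self]
  gcongr
  · exact Finset.single_le_sum (f := fun i => ‖N (d i u)‖ ^ 2) (fun _ _ => by positivity)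
      (Finset.mem_univ i)
  · exact Finset.single_le_sum (f := fun i => ‖N (x i u)‖ ^ 2) (fun _ _ => by positivity)
      (Finset.mem_univ i)

theorem norm_le_norm_oscillator (hxd : IsCanonicalPair N x d) (u : E) :
    ‖N u‖ ≤ ‖N (oscillator x d u)‖ := by
  have h1 := (hxd.norm_sq_le u).trans (real_inner_le_norm _ _)
  by_contra! h
  nlinarith [norm_nonneg (N (oscillator x d u)), norm_nonneg (N u)]

theorem norm_oscillator_pow_le_succ (hxd : IsCanonicalPair N x d) (k : ℕ) (u : E) :
    ‖N ((oscillator x d ^ k) u)‖ ≤ ‖N ((oscillator x d ^ (k + 1)) u)‖ := by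
  rw [pow_succ', Module.End.mul_apply]
  exact hxd.norm_le_norm_oscillator _

theorem weylSpan_le_dominatedBy_sqrt (hxd : IsCanonicalPair N x d) :
    weylSpan x d ≤ dominatedBy N fun u => √(inner ℝ (N (oscillator x d u)) (N u)) := by
  refine Submodule.span_le.2 ?_
  rintro S ((rfl | ⟨i, rfl⟩) | ⟨i, rfl⟩) <;>
    refine ⟨1, zero_le_one, fun u => (Real.le_sqrt_of_sq_le ?_).trans_eq (one_mul _).symm⟩
  · exact hxd.norm_sq_le u
  · exact hxd.norm_x_sq_le i u
  · exact hxd.norm_d_sq_le i u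

theorem inner_oscillator_self_le (hxd : IsCanonicalPair N x d) (u : E) :
    inner ℝ (N (oscillator x d u)) (N u) ≤ ‖N (oscillator x d u)‖ ^ 2 := by
  refine (real_inner_le_norm _ _).trans ?_
  rw [pow_two]
  exact mul_le_mul_of_nonneg_left (hxd.norm_le_norm_oscillator u) (norm_nonneg _)

theorem weylSpan_le_dominatedBy (hxd : IsCanonicalPair N x d) :
    weylSpan x d ≤ dominatedBy N fun u => ‖N (oscillator x d u)‖ := by
  intro S hS
  obtain ⟨C, hC, h⟩ := hxd.weylSpan_le_dominatedBy_sqrt hS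
  refine ⟨C, hC, fun u => (h u).trans (mul_le_mul_of_nonneg_left ?_ hC)⟩
  exact Real.sqrt_le_iff.2 ⟨norm_nonneg _, hxd.inner_oscillator_self_le u⟩

/-- A generator which is symmetric or antisymmetric keeps the form domain estimate. -/
theorem mul_mem_dominatedBy (hxd : IsCanonicalPair N x d) {S T : Module.End ℝ E}
    (hS : S ∈ weylSpan x d) (hT : T ∈ weylSpan x d)
    (hsymm : ∀ u v, |inner ℝ (N (T u)) (N v)| ≤ |inner ℝ (N u) (N (T v))|)
    (hform : ∀ u, ‖N (T u)‖ ^ 2 ≤ inner ℝ (N (oscillator x d u)) (N u)) :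
    S * T ∈ dominatedBy N fun u => ‖N (oscillator x d u)‖ := by
  obtain ⟨C, hC, hSC⟩ := hxd.weylSpan_le_dominatedBy_sqrt hS
  obtain ⟨D, hD, hTD⟩ := hxd.weylSpan_le_dominatedBy hT
  have hcomm : oscillator x d * T - T * oscillator x d ∈ weylSpan x d := by
    simpa only [add_zero, Submodule.pow_one] using
      hxd.commutator_mem 1 0 oscillator_mem (by rwa [zero_add, Submodule.pow_one])
  obtain ⟨F, hF, hTF⟩ := hxd.weylSpan_le_dominatedBy hcomm
  refine ⟨C * √(1 + 2 * (F * D)), by positivity, fun u => ?_⟩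
  rw [mul_assoc]
  refine (hSC (T u)).trans (mul_le_mul_of_nonneg_left ?_ hC)
  set m := inner ℝ (N (oscillator x d (T u))) (N (T u)) with hm
  set a := ‖N (oscillator x d u)‖ with ha
  have hm0 : 0 ≤ m := (sq_nonneg _).trans (hxd.norm_sq_le (T u))
  have hTu : oscillator x d (T u)
      = T (oscillator x d u) + (oscillator x d * T - T * oscillator x d) u := by
    simp
  have hsplit : m ≤ a * √m + F * D * a ^ 2 := by
    conv_lhs => rw [hm, hTu, map_add, inner_add_left]
    refine add_le_add ?_ ?_
    · refine (le_abs_self _).trans ((hsymm _ _).trans ((abs_real_inner_le_norm _ _).trans ?_))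
      exact mul_le_mul_of_nonneg_left (Real.le_sqrt_of_sq_le (hform (T u))) (norm_nonneg _)
    · refine (real_inner_le_norm _ _).trans ?_
      calc _ ≤ (F * a) * (D * a) := mul_le_mul (hTF u) (hTD u) (norm_nonneg _) (by positivity)
        _ = F * D * a ^ 2 := by ring
  rw [Real.sqrt_le_iff]
  refine ⟨by positivity, ?_⟩
  rw [mul_pow, Real.sq_sqrt (by positivity)]
  nlinarith [sq_nonneg (a - √m), Real.sq_sqrt hm0]

theorem weylSpan_sq_le_dominatedBy (hxd : IsCanonicalPair N x d) :
    weylSpan x d ^ 2 ≤ dominatedBy N fun u => ‖N (oscillator x d u)‖ := by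
  rw [Submodule.pow_succ, Submodule.pow_one, Submodule.mul_le]
  intro S hS T hT
  refine Submodule.span_induction (p := fun T _ =>
    S * T ∈ dominatedBy N fun u => ‖N (oscillator x d u)‖) ?_ ?_ ?_ ?_ hT
  · rintro T ((rfl | ⟨i, rfl⟩) | ⟨i, rfl⟩)
    · simpa using hxd.weylSpan_le_dominatedBy hS
    · exact hxd.mul_mem_dominatedBy hS (x_mem_weylSpan i) (fun u v => by rw [hxd.x_symm])
        (hxd.norm_x_sq_le i)
    · exact hxd.mul_mem_dominatedBy hS (d_mem_weylSpan i)
        (fun u v => by rw [hxd.d_symm, abs_neg]) (hxd.norm_d_sq_le i)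
  · simp
  · intro T T' _ _ h h'
    rw [mul_add]
    exact add_mem h h'
  · intro r T _ h
    rw [mul_smul_comm]
    exact Submodule.smul_mem _ r h

/-- Elliptic regularity: `A ^ k` dominates every operator of order at most `2 * k`. -/
theorem weylSpan_pow_le_dominatedBy (hxd : IsCanonicalPair N x d) (k : ℕ) :
    weylSpan x d ^ (2 * k) ≤ dominatedBy N fun u => ‖N ((oscillator x d ^ k) u)‖ := by
  induction k with
  | zero =>
    rw [mul_zero, Submodule.pow_zero, Submodule.one_le]
    exact ⟨1, zero_le_one, by simp⟩
  | succ k ih =>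
    rw [mul_add, mul_one, weylSpan_pow_add, Submodule.mul_le]
    intro S hS T hT
    obtain ⟨C, hC, hSC⟩ := ih hS
    obtain ⟨D, hD, hTD⟩ := hxd.weylSpan_sq_le_dominatedBy hT
    have hcomm : oscillator x d ^ k * T - T * oscillator x d ^ k ∈ weylSpan x d ^ (2 * k) := by
      cases k with
      | zero => simp only [pow_zero, one_mul, mul_one, sub_self, zero_mem]
      | succ k =>
        exact hxd.commutator_mem (2 * k + 1) 1 (pow_mem_weylSpan_pow oscillator_mem (k + 1)) hT
    obtain ⟨F, hF, hTF⟩ := ih hcomm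
    refine ⟨C * (D + F), by positivity, fun u => ?_⟩
    have hTu : (oscillator x d ^ k) (T u) = T ((oscillator x d ^ k) u)
        + (oscillator x d ^ k * T - T * oscillator x d ^ k) u := by simp
    rw [mul_assoc]
    refine (hSC (T u)).trans (mul_le_mul_of_nonneg_left ?_ hC)
    beta_reduce
    rw [hTu, map_add, add_mul]
    refine (norm_add_le _ _).trans (add_le_add ?_ ?_)
    · rw [pow_succ' (oscillator x d)]
      exact hTD _
    · exact (hTF u).trans (mul_le_mul_of_nonneg_left (hxd.norm_oscillator_pow_le_succ k u) hF)

/-- Approximate log-convexity of the mixed norms. -/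
theorem norm_mixed_sq_le (hxd : IsCanonicalPair N x d) (i l : ℕ) :
    ∃ C, 0 ≤ C ∧ ∀ u, ‖N ((sumSq x ^ (i + 1) * sumSq d ^ (l + 1)) u)‖ ^ 2
      ≤ (‖N ((sumSq x ^ i * sumSq d ^ (l + 2)) u)‖ ^ 2
          + ‖N ((sumSq x ^ (i + 2) * sumSq d ^ l) u)‖ ^ 2) / 2
        + C * (‖N ((oscillator x d ^ (i + l + 1)) u)‖
          * ‖N ((oscillator x d ^ (i + l + 2)) u)‖) := by
  set X := sumSq x
  set L := sumSq d
  have hX : X ∈ weylSpan x d ^ 2 := sumSq_x_mem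
  have hL : L ∈ weylSpan x d ^ 2 := sumSq_d_mem
  have hR : X ^ (i + 1) * L - L * X ^ (i + 1) ∈ weylSpan x d ^ (2 * (i + 1)) :=
    hxd.commutator_mem (2 * i + 1) 1 (pow_mem_weylSpan_pow hX (i + 1)) hL
  set R := X ^ (i + 1) * L - L * X ^ (i + 1) with hRdef
  have mem : ∀ {S T : Module.End ℝ E} {m n : ℕ}, S ∈ weylSpan x d ^ (2 * m) →
      T ∈ weylSpan x d ^ (2 * n) → S * T ∈ weylSpan x d ^ (2 * (m + n)) := by
    intro S T m n hS hT
    rw [mul_add]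
    exact mul_mem_weylSpan_pow hS hT
  obtain ⟨C₁, hC₁, h₁⟩ := hxd.weylSpan_pow_le_dominatedBy _ (mem hR (pow_mem_weylSpan_pow hL l))
  obtain ⟨C₂, hC₂, h₂⟩ := hxd.weylSpan_pow_le_dominatedBy _
    (mem (pow_mem_weylSpan_pow hX (i + 1)) (pow_mem_weylSpan_pow hL (l + 1)))
  obtain ⟨C₃, hC₃, h₃⟩ := hxd.weylSpan_pow_le_dominatedBy _
    (mem (pow_mem_weylSpan_pow hX (i + 1)) (pow_mem_weylSpan_pow hL l))
  obtain ⟨C₄, hC₄, h₄⟩ := hxd.weylSpan_pow_le_dominatedBy _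
    (mem hR (pow_mem_weylSpan_pow hL (l + 1)))
  rw [show i + 1 + (l + 1) = i + l + 2 by omega] at h₂ h₄
  rw [show i + 1 + l = i + l + 1 by omega] at h₁ h₃
  refine ⟨C₁ * C₂ + C₃ * C₄, by positivity, fun u => ?_⟩
  replace h₁ := h₁ u
  replace h₂ := h₂ u
  replace h₃ := h₃ u
  replace h₄ := h₄ u
  set a := ‖N ((oscillator x d ^ (i + l + 1)) u)‖
  set b := ‖N ((oscillator x d ^ (i + l + 2)) u)‖
  set w := (X ^ (i + 1) * L ^ l) u with hw
  set v := (X ^ (i + 1) * L ^ (l + 1)) u with hv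
  have e1 : (X ^ (i + 2) * L ^ l) u = X w := by
    rw [hw, ← Module.End.mul_apply, ← mul_assoc, ← pow_succ']
  have e2 : X ((X ^ i * L ^ (l + 2)) u) = L v + (R * L ^ (l + 1)) u := by
    rw [hv, ← Module.End.mul_apply, ← Module.End.mul_apply, ← LinearMap.add_apply, hRdef,
      pow_succ' X i, pow_succ' L (l + 1)]
    congr 1
    noncomm_ring
  have e3 : L w = v - (R * L ^ l) u := by
    rw [hv, hw, ← Module.End.mul_apply, ← LinearMap.sub_apply, hRdef, pow_succ' L l]
    congr 1
    noncomm_ring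
  have key : ‖N v‖ ^ 2 = inner ℝ (N ((X ^ (i + 2) * L ^ l) u)) (N ((X ^ i * L ^ (l + 2)) u))
      + inner ℝ (N ((R * L ^ l) u)) (N v) - inner ℝ (N w) (N ((R * L ^ (l + 1)) u)) := by
    rw [e1, hxd.inner_sumSq_x, e2, map_add, inner_add_right, ← hxd.inner_sumSq_d, e3, map_sub,
      inner_sub_left, real_inner_self_eq_norm_sq]
    ring
  have b1 : inner ℝ (N ((R * L ^ l) u)) (N v) ≤ (C₁ * a) * (C₂ * b) :=
    (real_inner_le_norm _ _).trans (mul_le_mul h₁ h₂ (norm_nonneg _) (by positivity))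
  have b2 : -inner ℝ (N w) (N ((R * L ^ (l + 1)) u)) ≤ (C₃ * a) * (C₄ * b) :=
    (neg_le_abs _).trans <| (abs_real_inner_le_norm _ _).trans
      (mul_le_mul h₃ h₄ (norm_nonneg _) (by positivity))
  have b3 := real_inner_le_norm (N ((X ^ (i + 2) * L ^ l) u)) (N ((X ^ i * L ^ (l + 2)) u))
  rw [key]
  nlinarith [sq_nonneg (‖N ((X ^ (i + 2) * L ^ l) u)‖ - ‖N ((X ^ i * L ^ (l + 2)) u)‖)]

/-- Mixed norms are controlled by the pure ones up to lower order terms. -/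
theorem exists_norm_mixed_sq_le (hxd : IsCanonicalPair N x d) (k : ℕ) :
    ∃ C, 0 ≤ C ∧ ∀ j l, j + l = k + 1 → ∀ u, ‖N ((sumSq x ^ j * sumSq d ^ l) u)‖ ^ 2
      ≤ ‖N ((sumSq d ^ (k + 1)) u)‖ ^ 2 + ‖N ((sumSq x ^ (k + 1)) u)‖ ^ 2
        + C * (‖N ((oscillator x d ^ k) u)‖ * ‖N ((oscillator x d ^ (k + 1)) u)‖) := by
  choose C hC h using hxd.norm_mixed_sq_le
  set D := ∑ i ∈ Finset.range k, C i (k - 1 - i) with hD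
  have hD0 : 0 ≤ D := Finset.sum_nonneg fun i _ => hC _ _
  refine ⟨D * (k + 1 : ℕ) ^ 2, by positivity, fun j l hjl u => ?_⟩
  set ab := ‖N ((oscillator x d ^ k) u)‖ * ‖N ((oscillator x d ^ (k + 1)) u)‖ with hab
  have hab0 : 0 ≤ ab := by positivity
  have main := le_add_of_approx_convex
    (a := fun j => ‖N ((sumSq x ^ j * sumSq d ^ (k + 1 - j)) u)‖ ^ 2) (e := D * ab) (k + 1)
    (fun j => by positivity) ?_ (show j ≤ k + 1 by omega)
  · obtain rfl : l = k + 1 - j := by omega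
    simp only [pow_zero, one_mul, Nat.sub_zero, Nat.sub_self, mul_one] at main
    have h1 : 0 ≤ D * ab * (j : ℝ) ^ 2 := by positivity
    have h2 : 0 ≤ D * ab * ((k + 1 : ℕ) : ℝ) ^ 2 := by positivity
    have h3 : 0 ≤ ‖N ((sumSq x ^ (k + 1)) u)‖ ^ 2 := by positivity
    rcases main with h | h <;> linarith
  · intro i hi
    obtain ⟨l, rfl⟩ : ∃ l, k = i + l + 1 := ⟨k - 1 - i, by omega⟩
    have h1 := h i l u
    have h2 : C i l ≤ D := by
      have := Finset.single_le_sum (f := fun m => C m (i + l + 1 - 1 - m)) (fun m _ => hC _ _)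
        (Finset.mem_range.2 (show i < i + l + 1 by omega))
      simpa only [hD, Nat.add_sub_cancel, Nat.add_sub_cancel_left] using this
    have h3 := mul_le_mul_of_nonneg_right h2 hab0
    simp only [show i + l + 1 + 1 - (i + 1) = l + 1 by omega,
      show i + l + 1 + 1 - i = l + 2 by omega, show i + l + 1 + 1 - (i + 2) = l by omega]
    exact h1.trans (add_le_add le_rfl h3)

/-- Powers of the oscillator are controlled by the pure powers. -/
theorem exists_norm_oscillator_pow_sq_le (hxd : IsCanonicalPair N x d) (k : ℕ) :
    ∃ C, 0 ≤ C ∧ ∀ u, ‖N ((oscillator x d ^ (k + 1)) u)‖ ^ 2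
      ≤ C * (‖N ((sumSq d ^ (k + 1)) u)‖ ^ 2 + ‖N ((sumSq x ^ (k + 1)) u)‖ ^ 2 + ‖N u‖ ^ 2) := by
  have hdom : oscillator x d ^ (k + 1) ∈ dominatedBy N fun u =>
      √(‖N ((sumSq d ^ (k + 1)) u)‖ ^ 2 + ‖N ((sumSq x ^ (k + 1)) u)‖ ^ 2
        + ‖N ((oscillator x d ^ k) u)‖ * ‖N ((oscillator x d ^ (k + 1)) u)‖) := by
    refine (show _ ⊔ _ ≤ dominatedBy N _ from sup_le (Submodule.span_le.2 ?_) ?_)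
      (hxd.oscillator_pow_mem_mixed k)
    · rintro _ ⟨j, l, hjl, rfl⟩
      obtain ⟨C, hC, h⟩ := hxd.exists_norm_mixed_sq_le k
      refine ⟨√(1 + C), by positivity, fun u => ?_⟩
      rw [← Real.sqrt_mul (by positivity)]
      refine Real.le_sqrt_of_sq_le ((h j l hjl u).trans ?_)
      have : 0 ≤ C * (‖N ((sumSq d ^ (k + 1)) u)‖ ^ 2 + ‖N ((sumSq x ^ (k + 1)) u)‖ ^ 2) := by
        positivity
      have : 0 ≤ ‖N ((oscillator x d ^ k) u)‖ * ‖N ((oscillator x d ^ (k + 1)) u)‖ := by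
        positivity
      linarith
    · intro T hT
      obtain ⟨C, hC, h⟩ := hxd.weylSpan_pow_le_dominatedBy k hT
      refine ⟨C, hC, fun u => (h u).trans (mul_le_mul_of_nonneg_left ?_ hC)⟩
      refine Real.le_sqrt_of_sq_le ?_
      have := mul_le_mul_of_nonneg_left (hxd.norm_oscillator_pow_le_succ k u)
        (norm_nonneg (N ((oscillator x d ^ k) u)))
      have : 0 ≤ ‖N ((sumSq d ^ (k + 1)) u)‖ ^ 2 + ‖N ((sumSq x ^ (k + 1)) u)‖ ^ 2 := by
        positivity
      linarith
  obtain ⟨C, hC, h⟩ := hdom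
  obtain ⟨F, hF, hinterp⟩ := hxd.norm_oscillator_pow_le_interpolation k
    (ε := 1 / (4 * (C ^ 2 + 1))) (by positivity)
  refine ⟨2 * C ^ 2 + 2 * (C ^ 2 * F) ^ 2, by positivity, fun u => ?_⟩
  have hu := pow_le_pow_left₀ (norm_nonneg _) (h u) 2
  rw [mul_pow, Real.sq_sqrt (by positivity)] at hu
  replace hinterp := hinterp u
  set a := ‖N ((oscillator x d ^ (k + 1)) u)‖
  set b := ‖N ((oscillator x d ^ k) u)‖
  set p := ‖N ((sumSq d ^ (k + 1)) u)‖
  set r := ‖N ((sumSq x ^ (k + 1)) u)‖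
  set z := ‖N u‖
  have ha : 0 ≤ a := norm_nonneg _
  have h1 : C ^ 2 * b ≤ a / 4 + C ^ 2 * F * z := by
    have h2 : C ^ 2 * (1 / (4 * (C ^ 2 + 1))) ≤ 1 / 4 := by
      rw [mul_one_div, div_le_div_iff₀ (by positivity) (by norm_num)]
      linarith
    have h3 := mul_le_mul_of_nonneg_left hinterp (sq_nonneg C)
    have h4 := mul_le_mul_of_nonneg_right h2 ha
    linarith
  have h5 := mul_le_mul_of_nonneg_right h1 ha
  have h6 : 0 ≤ C ^ 2 * z ^ 2 := by positivity
  have h7 : 0 ≤ (C ^ 2 * F) ^ 2 * (p ^ 2 + r ^ 2) := by positivity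
  nlinarith [sq_nonneg (a / 2 - C ^ 2 * F * z)]

end IsCanonicalPair

section Schwartz

open SchwartzMap LineDeriv

/-- Multiplication by the `i`-th coordinate on Schwartz functions. -/
def coordMul (i : Fin 2) : Module.End ℝ (SchwartzMap E2 ℂ) :=
  (smulLeftCLM ℂ fun y : E2 => y i).toLinearMap

/-- The `i`-th partial derivative on Schwartz functions. -/
def partialDeriv (i : Fin 2) : Module.End ℝ (SchwartzMap E2 ℂ) :=
  (lineDerivOpCLM ℝ (SchwartzMap E2 ℂ) (EuclideanSpace.single i (1 : ℝ) : E2)).toLinearMap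

/-- The embedding of Schwartz functions in `L²`, as a real linear map. -/
def schwartzToL2 : SchwartzMap E2 ℂ →ₗ[ℝ] Lp ℂ 2 (volume : Measure E2) :=
  (toLpCLM ℝ ℂ 2 volume).toLinearMap

theorem coordMul_apply (i : Fin 2) (u : SchwartzMap E2 ℂ) (y : E2) :
    coordMul i u y = y i • u y :=
  smulLeftCLM_apply_apply (EuclideanSpace.proj i : E2 →L[ℝ] ℝ).hasTemperateGrowth u y

theorem partialDeriv_apply (i : Fin 2) (u : SchwartzMap E2 ℂ) (y : E2) :
    partialDeriv i u y = pd i u y := rfl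

theorem inner_schwartzToL2 (u v : SchwartzMap E2 ℂ) :
    inner ℝ (schwartzToL2 u) (schwartzToL2 v) = ∫ y, inner ℝ (u y) (v y) := by
  apply integral_congr_ae
  filter_upwards [u.coeFn_toLp 2 volume, v.coeFn_toLp 2 volume] with y hu hv
  exact congrArg₂ (inner ℝ) hu hv

theorem norm_schwartzToL2_sq (u : SchwartzMap E2 ℂ) :
    ‖schwartzToL2 u‖ ^ 2 = ∫ y, ‖u y‖ ^ 2 := by
  rw [← real_inner_self_eq_norm_sq, inner_schwartzToL2]
  simp only [real_inner_self_eq_norm_sq]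

theorem pd_coordMul (i j : Fin 2) (u : SchwartzMap E2 ℂ) (y : E2) :
    pd i (coordMul j u) y = (if i = j then u y else 0) + y j • pd i u y := by
  have h1 : HasFDerivAt (fun z : E2 => z j) (EuclideanSpace.proj j : E2 →L[ℝ] ℝ) y :=
    (EuclideanSpace.proj j : E2 →L[ℝ] ℝ).hasFDerivAt
  have h2 := (h1.smul (u.hasFDerivAt y)).fderiv
  have h3 : (coordMul j u : E2 → ℂ) = fun z => z j • u z := funext (coordMul_apply j u)
  rw [pd, h3, show (fun z => z j • u z) = (fun z : E2 => z j) • (u : E2 → ℂ) from rfl, h2]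
  by_cases hij : i = j
  · subst hij
    simp [pd, add_comm]
  · simp [pd, hij, Ne.symm hij]

theorem pd_comm (i j : Fin 2) (u : SchwartzMap E2 ℂ) (y : E2) :
    pd i (pd j u) y = pd j (pd i u) y := by
  have hsymm : IsSymmSndFDerivAt ℝ u y := by
    refine ContDiffAt.isSymmSndFDerivAt (n := 2) (u.smooth 2).contDiffAt ?_
    simp
  have hd : DifferentiableAt ℝ (fderiv ℝ u) y := (fderivCLM ℝ E2 ℂ u).differentiableAt
  have h (a b : E2) : fderiv ℝ (fun z => fderiv ℝ u z a) y b = fderiv ℝ (fderiv ℝ u) y b a := by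
    rw [fderiv_clm_apply hd (differentiableAt_const a)]
    simp
  unfold pd
  rw [h, h, hsymm.eq]

theorem isCanonicalPair_schwartz : IsCanonicalPair schwartzToL2 coordMul partialDeriv where
  x_symm i u v := by
    rw [inner_schwartzToL2, inner_schwartzToL2]
    simp only [coordMul_apply, real_inner_smul_left, real_inner_smul_right]
  d_symm i u v := by
    rw [inner_schwartzToL2, inner_schwartzToL2]
    have := integral_bilinear_lineDerivOp_right_eq_neg_left (μ := volume) u v (innerSL ℝ)
      (EuclideanSpace.single i (1 : ℝ) : E2)
    exact (neg_eq_iff_eq_neg.2 this).symm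
  x_comm i j := by
    ext u y
    simp only [Module.End.mul_apply, coordMul_apply]
    exact smul_comm _ _ _
  d_comm i j := by
    ext u y
    exact pd_comm i j u y
  comm i j := by
    ext u y
    simp only [LinearMap.sub_apply, Module.End.mul_apply, _root_.sub_apply, coordMul_apply,
      partialDeriv_apply, pd_coordMul, add_sub_cancel_right]
    split_ifs <;> rfl

theorem sumSq_coordMul_apply (u : SchwartzMap E2 ℂ) (y : E2) :
    sumSq coordMul u y = ‖y‖ ^ 2 • u y := by
  simp only [sumSq, LinearMap.sum_apply, Module.End.mul_apply, _root_.sum_apply,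
    coordMul_apply, smul_smul, ← Finset.sum_smul, EuclideanSpace.real_norm_sq_eq, pow_two (y _)]

theorem one_add_sumSq_coordMul_pow_apply (k : ℕ) (u : SchwartzMap E2 ℂ) (y : E2) :
    ((1 + sumSq coordMul) ^ k) u y = (1 + ‖y‖ ^ 2) ^ k • u y := by
  induction k generalizing u with
  | zero => simp
  | succ k ih =>
    rw [pow_succ _ k, Module.End.mul_apply, ih, pow_succ _ k, mul_smul, LinearMap.add_apply,
      _root_.add_apply, sumSq_coordMul_apply, add_smul, one_smul]
    rfl

theorem sumSq_coordMul_pow_apply (k : ℕ) (u : SchwartzMap E2 ℂ) (y : E2) :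
    (sumSq coordMul ^ k) u y = (‖y‖ ^ 2) ^ k • u y := by
  induction k generalizing u with
  | zero => simp
  | succ k ih =>
    rw [pow_succ _ k, Module.End.mul_apply, ih, pow_succ _ k, mul_smul, sumSq_coordMul_apply]

theorem sumSq_partialDeriv_apply (u : SchwartzMap E2 ℂ) :
    (sumSq partialDeriv u : E2 → ℂ) = lap u := by
  ext y
  simp only [sumSq, LinearMap.sum_apply, _root_.sum_apply]
  rfl

theorem oscillator_apply (u : SchwartzMap E2 ℂ) :
    (oscillator coordMul partialDeriv u : E2 → ℂ) = Aop u := by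
  ext y
  rw [Aop, ← sumSq_partialDeriv_apply, oscillator, LinearMap.add_apply, _root_.add_apply,
    sumSq_coordMul_apply]
  simp

theorem lap_iterate (k : ℕ) (u : SchwartzMap E2 ℂ) :
    lap^[k] (fun y => u y) = (sumSq partialDeriv ^ k) u := by
  induction k with
  | zero => rfl
  | succ k ih =>
    rw [Function.iterate_succ_apply', ih, pow_succ', Module.End.mul_apply,
      sumSq_partialDeriv_apply]

theorem Aop_iterate (k : ℕ) (u : SchwartzMap E2 ℂ) :
    Aop^[k] (fun y => u y) = (oscillator coordMul partialDeriv ^ k) u := by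
  induction k with
  | zero => rfl
  | succ k ih =>
    rw [Function.iterate_succ_apply', ih, pow_succ', Module.End.mul_apply, oscillator_apply]

theorem integral_weight_eq (k : ℕ) (u : SchwartzMap E2 ℂ) :
    ∫ y : E2, (1 + ‖y‖ ^ 2) ^ (2 * k) * ‖u y‖ ^ 2
      = ‖schwartzToL2 (((1 + sumSq coordMul) ^ k) u)‖ ^ 2 := by
  rw [norm_schwartzToL2_sq]
  congr 1 with y
  rw [one_add_sumSq_coordMul_pow_apply, norm_smul, mul_pow, Real.norm_eq_abs, sq_abs, ← pow_mul,
    mul_comm k]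

theorem norm_schwartzToL2_le {u v : SchwartzMap E2 ℂ} (h : ∀ y, ‖u y‖ ≤ ‖v y‖) :
    ‖schwartzToL2 u‖ ≤ ‖schwartzToL2 v‖ := by
  refine Lp.norm_le_norm_of_ae_le ?_
  filter_upwards [u.coeFn_toLp 2 volume, v.coeFn_toLp 2 volume] with y hu hv
  exact (congrArg norm hu).trans_le ((h y).trans_eq (congrArg norm hv).symm)

end Schwartz

/-- Equivalence of norms: `‖Aᵏ u‖²_{L²}` is comparable to
`‖Δᵏ u‖²_{L²} + ‖⟨x⟩^{2k} u‖²_{L²}` for Schwartz functions. -/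
theorem equivalence_of_norms (k : ℕ) (hk : 1 ≤ k) :
    ∃ C : ℝ, 0 < C ∧ ∀ u : SchwartzMap E2 ℂ,
      C⁻¹ * ((∫ x : E2, ‖lap^[k] (fun y => u y) x‖^2)
          + ∫ x : E2, (1 + ‖x‖^2)^(2*k) * ‖u x‖^2)
        ≤ (∫ x : E2, ‖Aop^[k] (fun y => u y) x‖^2) ∧
      (∫ x : E2, ‖Aop^[k] (fun y => u y) x‖^2)
        ≤ C * ((∫ x : E2, ‖lap^[k] (fun y => u y) x‖^2)
          + ∫ x : E2, (1 + ‖x‖^2)^(2*k) * ‖u x‖^2) := by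
  have hxd := isCanonicalPair_schwartz
  obtain ⟨m, rfl⟩ : ∃ m, k = m + 1 := ⟨k - 1, by omega⟩
  have hone : (1 : Module.End ℝ (SchwartzMap E2 ℂ)) ∈ weylSpan coordMul partialDeriv ^ 2 := by
    have h := Submodule.one_le.1 (one_le_weylSpan (x := coordMul) (d := partialDeriv))
    rw [← Submodule.pow_one (weylSpan _ _)] at h
    simpa only [mul_one] using mul_mem_weylSpan_pow h h
  obtain ⟨C₁, hC₁, h₁⟩ := hxd.weylSpan_pow_le_dominatedBy (m + 1)
    (pow_mem_weylSpan_pow sumSq_d_mem (m + 1))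
  obtain ⟨C₂, hC₂, h₂⟩ := hxd.weylSpan_pow_le_dominatedBy (m + 1)
    (pow_mem_weylSpan_pow (add_mem hone sumSq_x_mem) (m + 1))
  obtain ⟨C₃, hC₃, h₃⟩ := hxd.exists_norm_oscillator_pow_sq_le m
  refine ⟨C₁ ^ 2 + C₂ ^ 2 + 2 * C₃ + 1, by positivity, fun u => ?_⟩
  have hx : ‖schwartzToL2 ((sumSq coordMul ^ (m + 1)) u)‖
      ≤ ‖schwartzToL2 (((1 + sumSq coordMul) ^ (m + 1)) u)‖ := by
    refine norm_schwartzToL2_le fun y => ?_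
    rw [one_add_sumSq_coordMul_pow_apply, sumSq_coordMul_pow_apply, norm_smul, norm_smul,
      Real.norm_of_nonneg (by positivity), Real.norm_of_nonneg (by positivity)]
    gcongr
    linarith
  have hu : ‖schwartzToL2 u‖ ≤ ‖schwartzToL2 (((1 + sumSq coordMul) ^ (m + 1)) u)‖ := by
    refine norm_schwartzToL2_le fun y => ?_
    rw [one_add_sumSq_coordMul_pow_apply, norm_smul, Real.norm_of_nonneg (by positivity)]
    refine le_mul_of_one_le_left (norm_nonneg _) (one_le_pow₀ ?_)
    linarith [sq_nonneg ‖y‖]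
  rw [integral_weight_eq, lap_iterate, Aop_iterate, ← norm_schwartzToL2_sq, ← norm_schwartzToL2_sq]
  have h₁' := pow_le_pow_left₀ (norm_nonneg _) (h₁ u) 2
  have h₂' := pow_le_pow_left₀ (norm_nonneg _) (h₂ u) 2
  have h₃' := h₃ u
  have hx' := pow_le_pow_left₀ (norm_nonneg _) hx 2
  have hu' := pow_le_pow_left₀ (norm_nonneg _) hu 2
  rw [mul_pow] at h₁' h₂'
  set a := ‖schwartzToL2 ((oscillator coordMul partialDeriv ^ (m + 1)) u)‖ ^ 2
  set p := ‖schwartzToL2 ((sumSq partialDeriv ^ (m + 1)) u)‖ ^ 2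
  set q := ‖schwartzToL2 (((1 + sumSq coordMul) ^ (m + 1)) u)‖ ^ 2
  have ha : 0 ≤ a := sq_nonneg _
  have hp : 0 ≤ p := sq_nonneg _
  have hq : 0 ≤ q := sq_nonneg _
  constructor
  · rw [inv_mul_le_iff₀ (by positivity)]
    nlinarith [mul_nonneg hC₃ ha]
  · have h := mul_le_mul_of_nonneg_left (add_le_add (add_le_add le_rfl hx') hu' :
      p + _ + _ ≤ p + q + q) hC₃
    nlinarith [mul_nonneg hC₃ hp, mul_nonneg (add_nonneg (sq_nonneg C₁) (sq_nonneg C₂))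
      (add_nonneg hp hq)]
end
end

section
/- Let w be a Schwartz-regular solution of the linear equation i ∂ₜw − Δw + |x|² w = 0 and let ρ : ℝ² → ℝ be smooth with all derivatives of at most polynomial growth. Then for all t, d²/dt² ∫_{ℝ²} ρ(x) |w(t,x)|² dx = 4 ∫_{ℝ²} Σ_{k,l=1}^{2} ∂²_{kl} ρ(x) · ∂_{x_k} w(t,x) · ∂_{x_l} conj(w(t,x)) dx − ∫_{ℝ²} Δρ(x) · Δ( |w(t,·)|² )(x) dx − 4 ∫_{ℝ²} ( x · ∇ρ(x) ) |w(t,x)|² dx. -/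
open MeasureTheory Complex

noncomputable section

open scoped SchwartzMap LineDeriv ContDiff

/-- The coordinate derivative `∂ₖ` on complex Schwartz functions on the plane. -/
def dS (k : Fin 2) : 𝓢(E2, ℂ) →L[ℂ] 𝓢(E2, ℂ) :=
  LineDeriv.lineDerivOpCLM ℂ 𝓢(E2, ℂ) (EuclideanSpace.single k (1 : ℝ) : E2)

/-- Multiplication by the coordinate `xₖ` on complex Schwartz functions on the plane. -/
def xS (k : Fin 2) : 𝓢(E2, ℂ) →L[ℂ] 𝓢(E2, ℂ) :=
  SchwartzMap.smulLeftCLM ℂ (fun x : E2 => ((x k : ℝ) : ℂ))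

/-- The shifted harmonic oscillator `-Δ + |x|² + c` on Schwartz functions. -/
def hS (c : ℝ) : 𝓢(E2, ℂ) →L[ℂ] 𝓢(E2, ℂ) :=
  ∑ k, (xS k ∘L xS k - dS k ∘L dS k) + (c : ℂ) • ContinuousLinearMap.id ℂ _

theorem coord_hasTemperateGrowth (k : Fin 2) :
    Function.HasTemperateGrowth (fun x : E2 => ((x k : ℝ) : ℂ)) :=
  (Complex.ofRealCLM ∘L (EuclideanSpace.proj k : E2 →L[ℝ] ℝ)).hasTemperateGrowth

theorem xS_apply (k : Fin 2) (f : 𝓢(E2, ℂ)) (x : E2) : xS k f x = (x k : ℂ) * f x := by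
  simp [xS, SchwartzMap.smulLeftCLM_apply_apply (coord_hasTemperateGrowth k)]

theorem dS_apply (k : Fin 2) (f : 𝓢(E2, ℂ)) (x : E2) : dS k f x = pd k f x := by
  simp only [dS, LineDeriv.lineDerivOpCLM_apply, SchwartzMap.lineDerivOp_apply_eq_fderiv, pd]

theorem coe_dS (k : Fin 2) (f : 𝓢(E2, ℂ)) : (dS k f : E2 → ℂ) = pd k f :=
  funext (dS_apply k f)

theorem norm_sq_E2 (x : E2) : ‖x‖ ^ 2 = x 0 ^ 2 + x 1 ^ 2 := by
  simp [EuclideanSpace.norm_sq_eq]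

theorem hS_eq (c : ℝ) (f : 𝓢(E2, ℂ)) :
    hS c f = xS 0 (xS 0 f) - dS 0 (dS 0 f) + (xS 1 (xS 1 f) - dS 1 (dS 1 f)) + (c : ℂ) • f := by
  simp [hS]
  abel

theorem hS_apply (c : ℝ) (f : 𝓢(E2, ℂ)) (x : E2) :
    hS c f x = -lap f x + (‖x‖ : ℂ) ^ 2 * f x + c * f x := by
  have h : ((‖x‖ : ℂ)) ^ 2 = (x 0 : ℂ) ^ 2 + (x 1 : ℂ) ^ 2 := by
    exact_mod_cast congrArg Complex.ofReal (norm_sq_E2 x)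
  simp only [hS_eq, add_apply, sub_apply, smul_apply,
    xS_apply, dS_apply, coe_dS, lap, Fin.sum_univ_two, h, smul_eq_mul]
  ring

theorem dS_comm (k l : Fin 2) (f : 𝓢(E2, ℂ)) : dS k (dS l f) = dS l (dS k f) := by
  ext x
  simp only [dS_apply, coe_dS]
  change fderiv ℝ (fun y => fderiv ℝ f y (EuclideanSpace.single l 1)) x _ =
    fderiv ℝ (fun y => fderiv ℝ f y (EuclideanSpace.single k 1)) x _
  have h2 : DifferentiableAt ℝ (fderiv ℝ (f : E2 → ℂ)) x :=
    ((f.smooth ⊤).fderiv_right (m := 1) (by norm_cast)).differentiable one_ne_zero x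
  have hs := (f.smooth ⊤).contDiffAt.isSymmSndFDerivAt (x := x) (by simp; norm_cast)
  rw [fderiv_clm_apply h2 (by fun_prop), fderiv_clm_apply h2 (by fun_prop)]
  simpa using hs.eq _ _

theorem xS_comm (k l : Fin 2) (f : 𝓢(E2, ℂ)) : xS k (xS l f) = xS l (xS k f) := by
  ext x
  simp only [xS_apply]
  ring

theorem dS_xS (k l : Fin 2) (f : 𝓢(E2, ℂ)) :
    dS k (xS l f) = xS l (dS k f) + if k = l then f else 0 := by
  ext x
  have hx : (xS l f : E2 → ℂ) = fun y => ((y l : ℝ) : ℂ) * f y := funext (xS_apply l f)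
  have h1 : HasFDerivAt (fun y : E2 => ((y l : ℝ) : ℂ))
      (Complex.ofRealCLM ∘L (EuclideanSpace.proj l : E2 →L[ℝ] ℝ)) x :=
    (Complex.ofRealCLM ∘L (EuclideanSpace.proj l : E2 →L[ℝ] ℝ)).hasFDerivAt
  rw [add_apply, xS_apply, dS_apply, dS_apply, pd, pd, hx]
  change fderiv ℝ ((fun y : E2 => ((y l : ℝ) : ℂ)) * ⇑f) x _ = _
  rw [(h1.mul (f.hasFDerivAt x)).fderiv]
  by_cases h : k = l
  · subst h; simp
  · simp [h, Ne.symm h]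

theorem raise_hS (c : ℝ) (k : Fin 2) (f : 𝓢(E2, ℂ)) :
    xS k (hS c f) - dS k (hS c f) = hS (c - 2) (xS k f - dS k f) := by
  fin_cases k <;>
  · simp [hS_eq, dS_xS, xS_comm 1 0, dS_comm 1 0]
    module

theorem lower_hS (c : ℝ) (k : Fin 2) (f : 𝓢(E2, ℂ)) :
    xS k (hS c f) + dS k (hS c f) = hS (c + 2) (xS k f + dS k f) := by
  fin_cases k <;>
  · simp [hS_eq, dS_xS, xS_comm 1 0, dS_comm 1 0]
    module

theorem inner_toLp (f g : 𝓢(E2, ℂ)) :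
    inner ℂ (f.toLp 2) (g.toLp 2) = ∫ x, (starRingEnd ℂ) (f x) * g x := by
  simp [SchwartzMap.inner_toL2_toL2_eq, mul_comm]

theorem inner_dS (k : Fin 2) (f g : 𝓢(E2, ℂ)) :
    inner ℂ ((dS k f).toLp 2) (g.toLp 2) = -inner ℂ (f.toLp 2) ((dS k g).toLp 2) := by
  have := SchwartzMap.integral_bilinear_lineDerivOp_right_eq_neg_left (μ := volume) f g
    ((ContinuousLinearMap.mul ℝ ℂ).comp (Complex.conjCLE : ℂ →L[ℝ] ℂ))
    (EuclideanSpace.single k (1 : ℝ))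
  rw [inner_toLp, inner_toLp, eq_neg_iff_add_eq_zero, add_comm, ← eq_neg_iff_add_eq_zero]
  exact this

theorem inner_xS (k : Fin 2) (f g : 𝓢(E2, ℂ)) :
    inner ℂ ((xS k f).toLp 2) (g.toLp 2) = inner ℂ (f.toLp 2) ((xS k g).toLp 2) := by
  rw [inner_toLp, inner_toLp]
  congr 1; ext x
  simp only [xS_apply, map_mul, Complex.conj_ofReal]
  ring

theorem inner_hS (c : ℝ) (f g : 𝓢(E2, ℂ)) :
    inner ℂ ((hS c f).toLp 2) (g.toLp 2) = inner ℂ (f.toLp 2) ((hS c g).toLp 2) := by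
  simp only [← SchwartzMap.toLpCLM_apply (𝕜 := ℂ), hS_eq, map_add, map_sub, map_smul,
    inner_add_left, inner_add_right, inner_sub_left, inner_sub_right, inner_smul_left,
    inner_smul_right, Complex.conj_ofReal]
  simp only [SchwartzMap.toLpCLM_apply, inner_dS, inner_xS, neg_neg]

/-- `HasTimeDeriv v v'`: the family `v` of Schwartz functions is jointly smooth in time and
space, with pointwise time derivative `v'`. -/
def HasTimeDeriv (v v' : ℝ → 𝓢(E2, ℂ)) : Prop :=
  ContDiff ℝ ∞ (fun p : ℝ × E2 => v p.1 p.2) ∧ ∀ t x, HasDerivAt (fun s => v s x) (v' t x) t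

namespace HasTimeDeriv

variable {u u' v v' : ℝ → 𝓢(E2, ℂ)}

theorem fderiv_left (h : HasTimeDeriv v v') (t : ℝ) (x : E2) :
    fderiv ℝ (fun p : ℝ × E2 => v p.1 p.2) (t, x) (1, 0) = v' t x := by
  have h1 : HasDerivAt (fun s : ℝ => (s, x)) ((1 : ℝ), (0 : E2)) t :=
    (hasDerivAt_id t).prodMk (hasDerivAt_const t x)
  have h2 := ((h.1.differentiable (by simp)) (t, x)).hasFDerivAt.comp_hasDerivAt t h1
  exact h2.unique (h.2 t x)

theorem fderiv_right (h : HasTimeDeriv v v') (t : ℝ) (x y : E2) :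
    fderiv ℝ (fun p : ℝ × E2 => v p.1 p.2) (t, x) (0, y) = fderiv ℝ (v t) x y := by
  have h1 : HasFDerivAt (fun z : E2 => (t, z)) (ContinuousLinearMap.inr ℝ ℝ E2) x :=
    hasFDerivAt_prodMk_right t x
  have h2 := ((h.1.differentiable (by simp)) (t, x)).hasFDerivAt.comp x h1
  have h3 : HasFDerivAt (v t) _ x := h2
  rw [h3.fderiv]
  simp

theorem contDiff_deriv (h : HasTimeDeriv v v') :
    ContDiff ℝ ∞ (fun p : ℝ × E2 => v' p.1 p.2) := by
  have : (fun p : ℝ × E2 => v' p.1 p.2) =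
      fun p => fderiv ℝ (fun p : ℝ × E2 => v p.1 p.2) p (1, 0) :=
    funext fun p => (h.fderiv_left p.1 p.2).symm
  rw [this]
  exact (h.1.fderiv_right (m := ∞) (by simp)).clm_apply contDiff_const

theorem dS (k : Fin 2) (h : HasTimeDeriv v v') :
    HasTimeDeriv (fun t => dS k (v t)) (fun t => dS k (v' t)) := by
  set J : ℝ × E2 → ℂ := fun p => v p.1 p.2 with hJ
  set e : E2 := EuclideanSpace.single k 1
  have hfd : ContDiff ℝ ∞ (fderiv ℝ J) := h.1.fderiv_right (m := ∞) (by simp)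
  have hk : (fun p : ℝ × E2 => _root_.dS k (v p.1) p.2) = fun p => fderiv ℝ J p (0, e) :=
    funext fun p => by rw [dS_apply]; exact (h.fderiv_right p.1 p.2 e).symm
  have hsm : ContDiff ℝ ∞ (fun p => fderiv ℝ J p (0, e)) := hfd.clm_apply contDiff_const
  refine ⟨hk ▸ hsm, fun t x => ?_⟩
  have h1 : HasDerivAt (fun s : ℝ => (s, x)) ((1 : ℝ), (0 : E2)) t :=
    (hasDerivAt_id t).prodMk (hasDerivAt_const t x)
  have h2 := ((hsm.differentiable (by simp)) (t, x)).hasFDerivAt.comp_hasDerivAt t h1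
  have h3 : (fun s => _root_.dS k (v s) x) = fun s => fderiv ℝ J (s, x) (0, e) :=
    funext fun s => congrFun hk (s, x)
  rw [h3]
  refine h2.congr_deriv (Eq.symm ?_)
  have hd : DifferentiableAt ℝ (fderiv ℝ J) (t, x) := hfd.differentiable (by simp) _
  have h4 : HasFDerivAt (fun z : E2 => (t, z)) (ContinuousLinearMap.inr ℝ ℝ E2) x :=
    hasFDerivAt_prodMk_right t x
  have h5 : (v' t : E2 → ℂ) = fun z => fderiv ℝ J (t, z) (1, 0) :=
    funext fun z => (h.fderiv_left t z).symm
  have h6 := ((hd.clm_apply (differentiableAt_const ((1 : ℝ), (0 : E2)))).hasFDerivAt).comp x h4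
  replace h6 := h6.congr_of_eventuallyEq (f₁ := v' t) (Filter.Eventually.of_forall (congrFun h5))
  have hs := (h.1.contDiffAt.isSymmSndFDerivAt (x := (t, x)) (by simp; norm_cast)).eq
    ((0 : ℝ), e) ((1 : ℝ), (0 : E2))
  beta_reduce
  rw [dS_apply, pd, h6.fderiv, fderiv_clm_apply hd (by fun_prop),
    fderiv_clm_apply hd (by fun_prop)]
  simpa using hs

theorem xS (k : Fin 2) (h : HasTimeDeriv v v') :
    HasTimeDeriv (fun t => xS k (v t)) (fun t => xS k (v' t)) := by
  refine ⟨?_, fun t x => ?_⟩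
  · simp only [xS_apply]
    exact ((Complex.ofRealCLM.contDiff.comp
      ((EuclideanSpace.proj k : E2 →L[ℝ] ℝ).contDiff)).comp contDiff_snd).mul h.1
  · simp only [xS_apply]
    exact (h.2 t x).const_mul _

theorem add (h : HasTimeDeriv v v') (g : HasTimeDeriv u u') :
    HasTimeDeriv (fun t => v t + u t) (fun t => v' t + u' t) :=
  ⟨h.1.add g.1, fun t x => (h.2 t x).add (g.2 t x)⟩

theorem sub (h : HasTimeDeriv v v') (g : HasTimeDeriv u u') :
    HasTimeDeriv (fun t => v t - u t) (fun t => v' t - u' t) :=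
  ⟨h.1.sub g.1, fun t x => (h.2 t x).sub (g.2 t x)⟩

theorem const_smul (c : ℂ) (h : HasTimeDeriv v v') :
    HasTimeDeriv (fun t => c • v t) (fun t => c • v' t) :=
  ⟨contDiff_const.smul h.1, fun t x => (h.2 t x).const_mul c⟩

theorem shift (a : ℝ) (h : HasTimeDeriv v v') :
    HasTimeDeriv (fun t => v (t + a)) (fun t => v' (t + a)) :=
  ⟨h.1.comp ((contDiff_fst.add contDiff_const).prodMk contDiff_snd),
    fun t x => (h.2 (t + a) x).comp_add_const t a⟩

theorem hS (c : ℝ) (h : HasTimeDeriv v v') :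
    HasTimeDeriv (fun t => hS c (v t)) (fun t => hS c (v' t)) := by
  simp only [hS_eq]
  exact ((((h.xS 0).xS 0).sub ((h.dS 0).dS 0)).add (((h.xS 1).xS 1).sub ((h.dS 1).dS 1))).add
    (h.const_smul c)

end HasTimeDeriv

/-- A smooth solution of `∂ₜ v = i (-Δ + |x|² + c) v`. -/
def OscSol (c : ℝ) (v : ℝ → 𝓢(E2, ℂ)) : Prop :=
  HasTimeDeriv v (fun t => I • hS c (v t))

namespace OscSol

variable {c : ℝ} {u v : ℝ → 𝓢(E2, ℂ)}

theorem hS (h : OscSol c v) : OscSol c (fun t => hS c (v t)) := by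
  have := HasTimeDeriv.hS c h
  simp only [map_smul] at this
  exact this

theorem raise (k : Fin 2) (h : OscSol c v) :
    OscSol (c - 2) (fun t => xS k (v t) - dS k (v t)) := by
  have := (HasTimeDeriv.xS k h).sub (HasTimeDeriv.dS k h)
  simp only [map_smul, ← smul_sub, raise_hS] at this
  exact this

theorem lower (k : Fin 2) (h : OscSol c v) :
    OscSol (c + 2) (fun t => xS k (v t) + dS k (v t)) := by
  have := (HasTimeDeriv.xS k h).add (HasTimeDeriv.dS k h)
  simp only [map_smul, ← smul_add, lower_hS] at this
  exact this

theorem sub (h : OscSol c v) (g : OscSol c u) : OscSol c (fun t => v t - u t) := by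
  have := HasTimeDeriv.sub h g
  simp only [← smul_sub, ← map_sub] at this
  exact this

theorem shift (a : ℝ) (h : OscSol c v) : OscSol c (fun t => v (t + a)) :=
  HasTimeDeriv.shift a h

theorem continuous (h : OscSol c v) : Continuous (fun p : ℝ × E2 => v p.1 p.2) := h.1.continuous

end OscSol

theorem IsLinSolution.oscSol {w : ℝ → 𝓢(E2, ℂ)} (hw : IsLinSolution w) : OscSol 0 w := by
  refine ⟨hw.1, fun t x => ?_⟩
  have hd : DifferentiableAt ℝ (fun s => w s x) t :=
    ((hw.1.comp (contDiff_id.prodMk contDiff_const)).differentiable (by simp)) t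
  have h := hw.2 t x
  have h2 : deriv (fun s => w s x) t = (I • _root_.hS 0 (w t)) x := by
    rw [smul_apply, hS_apply, smul_eq_mul, ofReal_zero]
    linear_combination (-I) * h + deriv (fun s => w s x) t * I_sq
  exact h2 ▸ hd.hasDerivAt

section Baire

open Set Filter Topology

/-- A lower semicontinuous function on the line that is constant on every interval on which it is
bounded above is constant. -/
theorem eq_of_const_of_bddAbove {N : ℝ → ℝ} (hcl : ∀ M, IsClosed {t | N t ≤ M})
    (hb : ∀ a b M, a ≤ b → (∀ t ∈ Icc a b, N t ≤ M) → N a = N b) (s t : ℝ) : N s = N t := by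
  set U : Set ℝ := {t | ∃ M, ∀ᶠ s in 𝓝 t, N s ≤ M} with hU
  have hUo : IsOpen U := by
    rw [isOpen_iff_mem_nhds]
    rintro t ⟨M, hM⟩
    filter_upwards [eventually_eventually_nhds.2 hM] with s hs using ⟨M, hs⟩
  have hconst : ∀ a b, a ≤ b → Icc a b ⊆ U → N a = N b := by
    intro a b hab hsub
    have hcomp : ∃ M, ∀ t ∈ Icc a b, N t ≤ M := by
      refine isCompact_Icc.induction_on (p := fun S => ∃ M, ∀ t ∈ S, N t ≤ M) ⟨0, by simp⟩
        (fun S T hST ⟨M, hM⟩ => ⟨M, fun t ht => hM t (hST ht)⟩) ?_ ?_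
      · rintro S T ⟨M, hM⟩ ⟨M', hM'⟩
        refine ⟨max M M', fun t ht => ?_⟩
        rcases ht with ht | ht
        · exact (hM t ht).trans (le_max_left _ _)
        · exact (hM' t ht).trans (le_max_right _ _)
      · intro x hx
        obtain ⟨M, hM⟩ := hsub hx
        exact ⟨_, mem_nhdsWithin_of_mem_nhds hM, M, fun t ht => ht⟩
    obtain ⟨M, hM⟩ := hcomp
    exact hb a b M hab hM
  have hUuniv : Uᶜ = ∅ := by
    by_contra hne
    obtain ⟨z, hz⟩ := nonempty_iff_ne_empty.2 hne
    have hF : IsClosed Uᶜ := hUo.isClosed_compl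
    have : CompleteSpace (Uᶜ : Set ℝ) := hF.completeSpace_coe
    have : Nonempty (Uᶜ : Set ℝ) := ⟨⟨z, hz⟩⟩
    obtain ⟨n, x, hx⟩ := nonempty_interior_of_iUnion_of_closed
      (f := fun n : ℕ => {t : (Uᶜ : Set ℝ) | N t ≤ n})
      (fun n => (hcl n).preimage continuous_subtype_val)
      (eq_univ_of_forall fun t => mem_iUnion.2 (exists_nat_ge (N t)))
    rw [mem_interior_iff_mem_nhds, nhds_subtype_eq_comap, mem_comap] at hx
    obtain ⟨O, hO, hsub⟩ := hx
    obtain ⟨ε, hε, hball⟩ := Metric.mem_nhds_iff.1 hO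
    have hle : ∀ y ∈ Uᶜ, y ∈ Metric.ball (x : ℝ) ε → N y ≤ n :=
      fun y hy hyb => @hsub ⟨y, hy⟩ (hball hyb)
    refine x.2 ⟨n, ?_⟩
    filter_upwards [Metric.ball_mem_nhds (x : ℝ) hε] with y hy
    rw [Real.ball_eq_Ioo] at hy hle
    by_cases hyU : y ∈ Uᶜ
    · exact hle y hyU hy
    rcases le_or_gt (x : ℝ) y with hxy | hxy
    · obtain ⟨c, ⟨hcU, hc⟩, hmax⟩ := (isCompact_Icc.inter_left hF :
        IsCompact (Uᶜ ∩ Icc (x : ℝ) y)).exists_isGreatest ⟨x, x.2, le_refl _, hxy⟩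
      have hcn : N c ≤ n := hle c hcU ⟨by linarith [hc.1], by linarith [hc.2, hy.2]⟩
      have : N c = N y := by
        refine hb c y (max n (N y)) hc.2 fun r hr => ?_
        rcases eq_or_lt_of_le hr.1 with h | h
        · exact h ▸ hcn.trans (le_max_left _ _)
        · refine (hconst r y hr.2 fun q hq => ?_).le.trans (le_max_right _ _)
          by_contra hqU
          exact absurd (hmax ⟨hqU, hc.1.trans (hr.1.trans hq.1), hq.2⟩)
            (not_le.2 (h.trans_le hq.1))
      linarith
    · obtain ⟨c, ⟨hcU, hc⟩, hmin⟩ := (isCompact_Icc.inter_left hF :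
        IsCompact (Uᶜ ∩ Icc y (x : ℝ))).exists_isLeast ⟨x, x.2, hxy.le, le_refl _⟩
      have hcn : N c ≤ n := hle c hcU ⟨by linarith [hc.1, hy.1], by linarith [hc.2]⟩
      have : N y = N c := by
        refine hb y c (max n (N y)) hc.1 fun r hr => ?_
        rcases eq_or_lt_of_le hr.2 with h | h
        · exact h ▸ hcn.trans (le_max_left _ _)
        · refine (hconst y r hr.1 fun q hq => ?_).ge.trans (le_max_right _ _)
          by_contra hqU
          exact absurd (hmin ⟨hqU, hq.1, hq.2.trans (hr.2.trans hc.2)⟩)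
            (not_le.2 (hq.2.trans_lt h))
      linarith
  have hall : ∀ S : Set ℝ, S ⊆ U := by simp [compl_empty_iff.1 hUuniv]
  rcases le_total s t with h | h
  · exact hconst s t h (hall _)
  · exact (hconst t s h (hall _)).symm

end Baire

theorem norm_toLp_sq (f : 𝓢(E2, ℂ)) : ‖f.toLp 2‖ ^ 2 = ∫ x, ‖f x‖ ^ 2 := by
  have h2 : ∫ x, (starRingEnd ℂ) (f x) * f x = ((∫ x, ‖f x‖ ^ 2 : ℝ) : ℂ) := by
    rw [← integral_complex_ofReal]
    congr 1; ext x
    simp [Complex.conj_mul']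
  rw [norm_sq_eq_re_inner (𝕜 := ℂ), inner_toLp, h2]
  exact Complex.ofReal_re _

theorem integrable_norm_sq (f : 𝓢(E2, ℂ)) : Integrable (fun x => ‖f x‖ ^ 2) :=
  (f.memLp 2 volume).integrable_norm_pow (by simp)

theorem toLp_sub (f g : 𝓢(E2, ℂ)) :
    (f - g).toLp 2 volume = f.toLp 2 volume - g.toLp 2 volume := by
  simp only [← SchwartzMap.toLpCLM_apply (𝕜 := ℂ), map_sub]

theorem toLp_smul (a : ℂ) (f : 𝓢(E2, ℂ)) :
    (a • f).toLp 2 volume = a • f.toLp 2 volume := by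
  simp only [← SchwartzMap.toLpCLM_apply (𝕜 := ℂ), map_smul]

theorem isClosed_norm_toLp_le {v : ℝ → 𝓢(E2, ℂ)}
    (hv : Continuous (fun p : ℝ × E2 => v p.1 p.2)) (M : ℝ) :
    IsClosed {t | ‖(v t).toLp 2‖ ^ 2 ≤ M} := by
  have key : ∀ t, ENNReal.ofReal (‖(v t).toLp 2‖ ^ 2) = ∫⁻ x, ENNReal.ofReal (‖v t x‖ ^ 2) :=
    fun t => by
      rw [norm_toLp_sq, ofReal_integral_eq_lintegral_ofReal (integrable_norm_sq _)
        (Filter.Eventually.of_forall fun x => by positivity)]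
  refine IsSeqClosed.isClosed fun s t hs ht => ?_
  have hM : 0 ≤ M := (sq_nonneg _).trans (hs 0)
  rw [Set.mem_ofPred_eq, ← ENNReal.ofReal_le_ofReal_iff hM, key]
  have hlim : ∀ x, Filter.liminf (fun n => ENNReal.ofReal (‖v (s n) x‖ ^ 2)) Filter.atTop =
      ENNReal.ofReal (‖v t x‖ ^ 2) := fun x => by
    refine Filter.Tendsto.liminf_eq ?_
    have hc : Continuous fun r => ENNReal.ofReal (‖v r x‖ ^ 2) :=
      ENNReal.continuous_ofReal.comp
        ((hv.comp (continuous_id.prodMk continuous_const)).norm.pow 2)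
    exact (hc.tendsto t).comp ht
  calc ∫⁻ x, ENNReal.ofReal (‖v t x‖ ^ 2)
      = ∫⁻ x, Filter.liminf (fun n => ENNReal.ofReal (‖v (s n) x‖ ^ 2)) Filter.atTop := by
        simp only [hlim]
    _ ≤ Filter.liminf (fun n => ∫⁻ x, ENNReal.ofReal (‖v (s n) x‖ ^ 2)) Filter.atTop :=
        lintegral_liminf_le fun n => by
          have := (v (s n)).continuous
          fun_prop
    _ ≤ ENNReal.ofReal M := by
        refine Filter.liminf_le_of_le (by isBoundedDefault) fun b hb => ?_
        obtain ⟨n, hn⟩ := hb.exists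
        exact hn.trans (by rw [← key]; exact ENNReal.ofReal_le_ofReal (hs n))

theorem integral_sub_integral_eq {g g' : ℝ → E2 → ℂ}
    (hd : ∀ t x, HasDerivAt (fun s => g s x) (g' t x) t)
    (hc : Continuous (fun p : ℝ × E2 => g' p.1 p.2)) (hi : ∀ t, Integrable (g t))
    (hi' : ∀ t, Integrable (g' t)) {a b C : ℝ} (hC : ∀ t ∈ Set.uIcc a b, ∫ x, ‖g' t x‖ ≤ C) :
    (∫ x, g b x) - ∫ x, g a x = ∫ τ in a..b, ∫ x, g' τ x := by
  rw [intervalIntegral_integral_swap]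
  · rw [← integral_sub (hi b) (hi a)]
    congr 1; ext x
    have hcx : Continuous fun τ => g' τ x := hc.comp (continuous_id.prodMk continuous_const)
    exact (intervalIntegral.integral_eq_sub_of_hasDerivAt (f := fun s => g s x)
      (fun t _ => hd t x) (hcx.intervalIntegrable _ _)).symm
  · have hae : AEStronglyMeasurable (fun p : ℝ × E2 => g' p.1 p.2)
        ((volume.restrict (Set.uIoc a b)).prod volume) := hc.aestronglyMeasurable
    refine (integrable_prod_iff hae).2 ⟨Filter.Eventually.of_forall hi', ?_⟩
    have hfin : IsFiniteMeasure (volume.restrict (Set.uIoc a b)) := by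
      rw [Set.uIoc]; infer_instance
    refine Integrable.of_bound (C := C) hae.norm.integral_prod_right' ?_
    refine (ae_restrict_iff' measurableSet_uIoc).2 (Filter.Eventually.of_forall fun t ht => ?_)
    rw [Real.norm_of_nonneg (by positivity)]
    exact hC t (Set.uIoc_subset_uIcc ht)

theorem hasDerivAt_integral_of_bdd {g g' g'' : ℝ → E2 → ℂ}
    (hd : ∀ t x, HasDerivAt (fun s => g s x) (g' t x) t)
    (hd' : ∀ t x, HasDerivAt (fun s => g' s x) (g'' t x) t)
    (hc' : Continuous (fun p : ℝ × E2 => g' p.1 p.2))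
    (hc'' : Continuous (fun p : ℝ × E2 => g'' p.1 p.2))
    (hi : ∀ t, Integrable (g t)) (hi' : ∀ t, Integrable (g' t)) (hi'' : ∀ t, Integrable (g'' t))
    {C' C'' : ℝ} (hC' : ∀ t, ∫ x, ‖g' t x‖ ≤ C') (hC'' : ∀ t, ∫ x, ‖g'' t x‖ ≤ C'') (t : ℝ) :
    HasDerivAt (fun s => ∫ x, g s x) (∫ x, g' t x) t := by
  have hlip : Continuous fun s => ∫ x, g' s x := by
    refine (LipschitzWith.of_dist_le_mul (K := C''.toNNReal) fun r s => ?_).continuous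
    rw [dist_eq_norm, integral_sub_integral_eq hd' hc'' hi' hi'' (fun t _ => hC'' t),
      Real.dist_eq]
    refine (intervalIntegral.norm_integral_le_of_norm_le_const fun τ _ => ?_)
    exact (norm_integral_le_integral_norm _).trans ((hC'' τ).trans (Real.le_coe_toNNReal _))
  have h := intervalIntegral.integral_hasDerivAt_right (hlip.intervalIntegrable 0 t)
    (hlip.stronglyMeasurableAtFilter _ _) hlip.continuousAt
  refine (h.const_add (∫ x, g 0 x)).congr_of_eventuallyEq (Filter.Eventually.of_forall fun s => ?_)
  have := integral_sub_integral_eq hd hc' hi hi' (a := 0) (b := s) (fun t _ => hC' t)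
  simp only [← this, add_sub_cancel]

theorem inner_sub_eq_integral {v v' : ℝ → 𝓢(E2, ℂ)} (h : HasTimeDeriv v v') {a b M : ℝ}
    (hM : ∀ t ∈ Set.uIcc a b, ‖(v' t).toLp 2‖ ≤ M) (f : 𝓢(E2, ℂ)) :
    inner ℂ (f.toLp 2) ((v b).toLp 2) - inner ℂ (f.toLp 2) ((v a).toLp 2) =
      ∫ τ in a..b, inner ℂ (f.toLp 2) ((v' τ).toLp 2) := by
  have hinteg : ∀ g : 𝓢(E2, ℂ), Integrable (fun x => (starRingEnd ℂ) (f x) * g x) := fun g =>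
    (f.memLp 2 volume).star.integrable_mul (g.memLp 2 volume)
  simp only [inner_toLp]
  refine integral_sub_integral_eq (g := fun t x => (starRingEnd ℂ) (f x) * v t x)
    (C := ‖f.toLp 2‖ ^ 2 + M ^ 2) (fun t x => (h.2 t x).const_mul _)
    ((Complex.continuous_conj.comp (f.continuous.comp continuous_snd)).mul
      h.contDiff_deriv.continuous) (fun t => hinteg (v t)) (fun t => hinteg (v' t)) fun t ht => ?_
  calc ∫ x, ‖(starRingEnd ℂ) (f x) * v' t x‖ ≤ ∫ x, (‖f x‖ ^ 2 + ‖v' t x‖ ^ 2) := by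
        refine integral_mono (hinteg (v' t)).norm
          ((integrable_norm_sq f).add (integrable_norm_sq (v' t))) fun x => ?_
        simp only [norm_mul, RCLike.norm_conj]
        nlinarith [sq_nonneg (‖f x‖ - ‖v' t x‖), sq_nonneg (‖f x‖ ), sq_nonneg (‖v' t x‖)]
    _ = ‖f.toLp 2‖ ^ 2 + ‖(v' t).toLp 2‖ ^ 2 := by
        rw [integral_add (integrable_norm_sq f) (integrable_norm_sq (v' t)), norm_toLp_sq,
          norm_toLp_sq]
    _ ≤ _ := by
        gcongr
        exact hM t ht

theorem eq_of_abs_sub_le_sq {m : ℝ → ℝ} {a b C : ℝ}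
    (h : ∀ s ∈ Set.Icc a b, ∀ t ∈ Set.Icc a b, |m t - m s| ≤ C * |t - s| ^ 2) {s t : ℝ}
    (hs : s ∈ Set.Icc a b) (ht : t ∈ Set.Icc a b) : m s = m t := by
  have hd : ∀ x ∈ Set.Icc a b, HasDerivWithinAt m 0 (Set.Icc a b) x := fun x hx => by
    have hO : (fun y => m y - m x) =O[nhdsWithin x (Set.Icc a b)] fun y => ‖y - x‖ ^ 2 := by
      refine Asymptotics.IsBigO.of_bound C ?_
      filter_upwards [self_mem_nhdsWithin] with y hy
      simpa using h x hx y hy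
    have := (hO.hasFDerivWithinAt hx one_lt_two).hasDerivWithinAt.add_const (m x)
    simpa using this
  have := (convex_Icc a b).norm_image_sub_le_of_norm_hasDerivWithin_le (C := 0) hd (by simp) hs ht
  simp only [zero_mul, norm_le_zero_iff, sub_eq_zero] at this
  exact this.symm

namespace OscSol

variable {c a b M s t : ℝ} {v : ℝ → 𝓢(E2, ℂ)}

theorem inner_sub_eq_integral (h : OscSol c v)
    (hM : ∀ t ∈ Set.Icc a b, ‖(_root_.hS c (v t)).toLp 2 volume‖ ≤ M)
    (hs : s ∈ Set.Icc a b) (ht : t ∈ Set.Icc a b) (f : 𝓢(E2, ℂ)) :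
    inner ℂ (f.toLp 2) ((v t).toLp 2) - inner ℂ (f.toLp 2) ((v s).toLp 2) =
      ∫ τ in s..t, I * inner ℂ (f.toLp 2) ((_root_.hS c (v τ)).toLp 2) := by
  have := _root_.inner_sub_eq_integral h (a := s) (b := t) (M := M) (fun τ hτ => by
    rw [toLp_smul, norm_smul, norm_I, one_mul]
    exact hM τ (Set.ordConnected_Icc.uIcc_subset hs ht hτ)) f
  simpa only [toLp_smul, inner_smul_right] using this

theorem norm_sub_le (h : OscSol c v)
    (hM : ∀ t ∈ Set.Icc a b, ‖(_root_.hS c (v t)).toLp 2 volume‖ ≤ M)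
    (hs : s ∈ Set.Icc a b) (ht : t ∈ Set.Icc a b) :
    ‖(v t).toLp 2 volume - (v s).toLp 2 volume‖ ≤ M * |t - s| := by
  set D := (v t).toLp 2 volume - (v s).toLp 2 volume with hD
  have h1 := h.inner_sub_eq_integral hM hs ht (v t - v s)
  rw [toLp_sub, ← inner_sub_right, ← hD, inner_self_eq_norm_sq_to_K] at h1
  have h2 : ‖D‖ ^ 2 ≤ ‖D‖ * M * |t - s| := by
    calc ‖D‖ ^ 2 = ‖((‖D‖ : ℂ)) ^ 2‖ := by simp
      _ ≤ _ := by
        erw [h1]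
        refine intervalIntegral.norm_integral_le_of_norm_le_const fun τ hτ => ?_
        rw [norm_mul, norm_I, one_mul]
        refine (norm_inner_le_norm _ _).trans ?_
        gcongr
        exact hM τ (Set.ordConnected_Icc.uIcc_subset hs ht (Set.uIoc_subset_uIcc hτ))
  rcases (norm_nonneg D).eq_or_lt with h0 | h0
  · rw [← h0]
    exact mul_nonneg ((norm_nonneg _).trans (hM s hs)) (abs_nonneg _)
  · nlinarith

theorem continuousOn_toLp (h : OscSol c v)
    (hM : ∀ t ∈ Set.Icc a b, ‖(_root_.hS c (v t)).toLp 2 volume‖ ≤ M) :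
    ContinuousOn (fun t => (v t).toLp 2 volume) (Set.Icc a b) := by
  refine (LipschitzOnWith.of_dist_le_mul (K := M.toNNReal) fun t ht s hs => ?_).continuousOn
  rw [dist_eq_norm, Real.dist_eq]
  exact (h.norm_sub_le hM hs ht).trans (by gcongr; exact Real.le_coe_toNNReal M)

theorem intervalIntegrable_inner (h : OscSol c v)
    (hM : ∀ t ∈ Set.Icc a b, ‖(_root_.hS c (v t)).toLp 2 volume‖ ≤ M)
    (hs : s ∈ Set.Icc a b) (ht : t ∈ Set.Icc a b) (f : 𝓢(E2, ℂ)) :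
    IntervalIntegrable (fun τ => inner ℂ (f.toLp 2 volume) ((v τ).toLp 2 volume)) volume s t :=
  (continuousOn_const.inner ((h.continuousOn_toLp hM).mono
    (Set.ordConnected_Icc.uIcc_subset hs ht))).intervalIntegrable

theorem norm_inner_sub_le (h : OscSol c v)
    (hM : ∀ t ∈ Set.Icc a b, ‖(_root_.hS c (v t)).toLp 2 volume‖ ≤ M)
    (hs : s ∈ Set.Icc a b) (ht : t ∈ Set.Icc a b) (f : 𝓢(E2, ℂ)) :
    ‖inner ℂ (f.toLp 2) ((v t).toLp 2) - inner ℂ (f.toLp 2) ((v s).toLp 2)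
      - (t - s) * (I * inner ℂ ((_root_.hS c f).toLp 2) ((v s).toLp 2))‖ ≤
      ‖(_root_.hS c f).toLp 2 volume‖ * M * |t - s| ^ 2 := by
  have hinteg := (h.intervalIntegrable_inner hM hs ht (_root_.hS c f)).const_mul I
  have e : ((t : ℂ) - s) * (I * inner ℂ ((_root_.hS c f).toLp 2) ((v s).toLp 2)) =
      ∫ _ in s..t, I * inner ℂ ((_root_.hS c f).toLp 2) ((v s).toLp 2) := by
    rw [intervalIntegral.integral_const, real_smul]; push_cast; rfl
  rw [h.inner_sub_eq_integral hM hs ht f]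
  simp only [← inner_hS]
  rw [e, ← intervalIntegral.integral_sub hinteg intervalIntegrable_const]
  refine (intervalIntegral.norm_integral_le_of_norm_le_const
    (C := ‖(_root_.hS c f).toLp 2 volume‖ * (M * |t - s|)) fun τ hτ => ?_).trans_eq (by ring)
  rw [← mul_sub, ← inner_sub_right, norm_mul, norm_I, one_mul]
  have hτ' := Set.ordConnected_Icc.uIcc_subset hs ht (Set.uIoc_subset_uIcc hτ)
  refine (norm_inner_le_norm _ _).trans ?_
  gcongr
  refine (h.norm_sub_le hM hs hτ').trans ?_
  have hM0 := (norm_nonneg _).trans (hM s hs)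
  gcongr ?_ * ?_
  exact Set.abs_sub_left_of_mem_uIcc (Set.uIoc_subset_uIcc hτ)

set_option maxHeartbeats 800000 in
theorem norm_inner_sub_sub_le (h : OscSol c v)
    (hM : ∀ t ∈ Set.Icc a b, ‖(_root_.hS c (v t)).toLp 2 volume‖ ≤ M)
    (hs : s ∈ Set.Icc a b) (ht : t ∈ Set.Icc a b) (f : 𝓢(E2, ℂ)) :
    ‖inner ℂ (f.toLp 2) ((v t).toLp 2) - inner ℂ (f.toLp 2) ((v s).toLp 2)
      - (t - s) * (I * inner ℂ ((_root_.hS c f).toLp 2) ((v s).toLp 2))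
      + (t - s) ^ 2 / 2 * inner ℂ ((_root_.hS c (_root_.hS c f)).toLp 2) ((v s).toLp 2)‖ ≤
      ‖(_root_.hS c (_root_.hS c f)).toLp 2 volume‖ * M * |t - s| ^ 3 := by
  have hinteg := (h.intervalIntegrable_inner hM hs ht (_root_.hS c f)).const_mul I
  set g := inner ℂ ((_root_.hS c f).toLp 2 volume) ((v s).toLp 2 volume)
  set q := inner ℂ ((_root_.hS c (_root_.hS c f)).toLp 2 volume) ((v s).toLp 2 volume)
  have hcont : Continuous fun τ : ℝ => I * (g + ((τ : ℂ) - s) * (I * q)) := by fun_prop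
  have e : ∫ τ in s..t, I * (g + ((τ : ℂ) - s) * (I * q)) =
      ((t : ℂ) - s) * (I * g) - ((t : ℂ) - s) ^ 2 / 2 * q := by
    have hd : ∀ τ : ℝ, HasDerivAt
        (fun τ : ℝ => ((τ : ℂ) - s) * (I * g) - ((τ : ℂ) - s) ^ 2 / 2 * q)
        (I * (g + ((τ : ℂ) - s) * (I * q))) τ := fun τ => by
      have h0 : HasDerivAt (fun τ : ℝ => (τ : ℂ) - s) 1 τ :=
        (Complex.ofRealCLM.hasDerivAt (x := τ)).sub_const _
      refine ((h0.mul_const (I * g)).sub (((h0.pow 2).div_const 2).mul_const q)).congr_deriv ?_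
      linear_combination (-(τ - s) * q) * I_sq
    rw [intervalIntegral.integral_eq_sub_of_hasDerivAt (fun τ _ => hd τ)
      (hcont.intervalIntegrable _ _)]
    simp
  rw [sub_add, ← e, h.inner_sub_eq_integral hM hs ht f]
  simp only [← inner_hS]
  rw [← intervalIntegral.integral_sub hinteg (hcont.intervalIntegrable _ _)]
  refine (intervalIntegral.norm_integral_le_of_norm_le_const
    (C := ‖(_root_.hS c (_root_.hS c f)).toLp 2 volume‖ * M * |t - s| ^ 2)
      fun τ hτ => ?_).trans_eq (by ring)
  rw [← mul_sub, ← sub_sub, norm_mul, norm_I, one_mul]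
  have hτ' := Set.ordConnected_Icc.uIcc_subset hs ht (Set.uIoc_subset_uIcc hτ)
  refine (h.norm_inner_sub_le hM hs hτ' (_root_.hS c f)).trans ?_
  have hM0 := (norm_nonneg _).trans (hM s hs)
  gcongr ?_ * ?_ ^ 2
  exact Set.abs_sub_left_of_mem_uIcc (Set.uIoc_subset_uIcc hτ)

end OscSol

theorem inner_hS_self_im (c : ℝ) (f : 𝓢(E2, ℂ)) :
    (inner ℂ ((hS c f).toLp 2 volume) (f.toLp 2 volume)).im = 0 := by
  have h : (starRingEnd ℂ) (inner ℂ ((hS c f).toLp 2 volume) (f.toLp 2 volume)) =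
      inner ℂ ((hS c f).toLp 2 volume) (f.toLp 2 volume) := by
    rw [inner_conj_symm, inner_hS]
  exact Complex.conj_eq_iff_im.1 h

namespace OscSol

variable {c a b M s t : ℝ} {v : ℝ → 𝓢(E2, ℂ)}

theorem abs_re_inner_sub_le (h : OscSol c v)
    (hM : ∀ t ∈ Set.Icc a b, ‖(_root_.hS c (v t)).toLp 2 volume‖ ≤ M)
    (hs : s ∈ Set.Icc a b) (ht : t ∈ Set.Icc a b) :
    |(inner ℂ ((v s).toLp 2 volume) ((v t).toLp 2 volume)).re - ‖(v s).toLp 2 volume‖ ^ 2| ≤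
      M ^ 2 * |t - s| ^ 2 := by
  have h1 := (Complex.abs_re_le_norm _).trans (h.norm_inner_sub_le hM hs ht (v s))
  rw [norm_sq_eq_re_inner (𝕜 := ℂ) ((v s).toLp 2 volume)]
  have h2 := inner_hS_self_im c (v s)
  have h3 : (((t : ℂ) - s) * (I * inner ℂ ((_root_.hS c (v s)).toLp 2 volume)
      ((v s).toLp 2 volume))).re = 0 := by
    rw [← ofReal_sub, re_ofReal_mul, I_mul_re, h2]
    simp
  rw [sub_re, sub_re, h3, sub_zero] at h1
  refine h1.trans ?_
  have hM0 := (norm_nonneg _).trans (hM s hs)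
  rw [pow_two M]
  gcongr
  exact hM s hs

theorem norm_eq_of_bdd (h : OscSol c v)
    (hM : ∀ t ∈ Set.Icc a b, ‖(_root_.hS c (v t)).toLp 2 volume‖ ≤ M)
    (hs : s ∈ Set.Icc a b) (ht : t ∈ Set.Icc a b) :
    ‖(v s).toLp 2 volume‖ ^ 2 = ‖(v t).toLp 2 volume‖ ^ 2 := by
  refine eq_of_abs_sub_le_sq (m := fun t => ‖(v t).toLp 2 volume‖ ^ 2) (C := 2 * M ^ 2)
    (fun s hs t ht => ?_) hs ht
  have h1 := abs_le.1 (h.abs_re_inner_sub_le hM hs ht)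
  have h2 := abs_le.1 (h.abs_re_inner_sub_le hM ht hs)
  have h3 : (inner ℂ ((v s).toLp 2 volume) ((v t).toLp 2 volume)).re =
    (inner ℂ ((v t).toLp 2 volume) ((v s).toLp 2 volume)).re :=
    inner_re_symm (𝕜 := ℂ) ((v s).toLp 2 volume) ((v t).toLp 2 volume)
  rw [abs_sub_comm] at h2
  rw [abs_le]
  constructor <;> linarith [h1.1, h1.2, h2.1, h2.2]

theorem abs_norm_sub_sq_sub_le (h : OscSol c v)
    (hM : ∀ t ∈ Set.Icc a b, ‖(_root_.hS c (v t)).toLp 2 volume‖ ≤ M)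
    (hs : s ∈ Set.Icc a b) (ht : t ∈ Set.Icc a b) :
    |‖(v t).toLp 2 volume - (v s).toLp 2 volume‖ ^ 2
      - (t - s) ^ 2 * ‖(_root_.hS c (v s)).toLp 2 volume‖ ^ 2| ≤
      2 * (‖(_root_.hS c (_root_.hS c (v s))).toLp 2 volume‖ * M * |t - s| ^ 3) := by
  have h1 := (Complex.abs_re_le_norm _).trans (h.norm_inner_sub_sub_le hM hs ht (v s))
  have h2 := inner_hS_self_im c (v s)
  have h3 : (((t : ℂ) - s) * (I * inner ℂ ((_root_.hS c (v s)).toLp 2 volume)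
      ((v s).toLp 2 volume))).re = 0 := by
    rw [← ofReal_sub, re_ofReal_mul, I_mul_re, h2]
    simp
  have h4 : (((t : ℂ) - s) ^ 2 / 2 * inner ℂ ((_root_.hS c (_root_.hS c (v s))).toLp 2 volume)
      ((v s).toLp 2 volume)).re = (t - s) ^ 2 / 2 * ‖(_root_.hS c (v s)).toLp 2 volume‖ ^ 2 := by
    rw [inner_hS, norm_sq_eq_re_inner (𝕜 := ℂ)]
    have : ((t : ℂ) - s) ^ 2 / 2 = (((t - s) ^ 2 / 2 : ℝ) : ℂ) := by push_cast; ring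
    rw [this, re_ofReal_mul]
    rfl
  have h5 : (inner ℂ ((v s).toLp 2 volume) ((v s).toLp 2 volume)).re =
      ‖(v s).toLp 2 volume‖ ^ 2 := (norm_sq_eq_re_inner (𝕜 := ℂ) ((v s).toLp 2 volume)).symm
  rw [add_re, sub_re, sub_re, h3, h4, h5, sub_zero] at h1
  have h6 := h.norm_eq_of_bdd hM hs ht
  have h7 := norm_sub_sq (𝕜 := ℂ) ((v t).toLp 2 volume) ((v s).toLp 2 volume)
  rw [inner_re_symm] at h7
  change _ = _ - 2 * (inner ℂ ((v s).toLp 2 volume) ((v t).toLp 2 volume)).re + _ at h7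
  rw [h7, ← h6]
  rw [abs_le] at h1 ⊢
  constructor <;> linarith [h1.1, h1.2]

theorem norm_hS_eq_of_bdd (h : OscSol c v) (hab : a ≤ b)
    (hM : ∀ t ∈ Set.Icc a b, ‖(_root_.hS c (v t)).toLp 2 volume‖ ≤ M) :
    ‖(_root_.hS c (v a)).toLp 2 volume‖ ^ 2 = ‖(_root_.hS c (v b)).toLp 2 volume‖ ^ 2 := by
  rcases hab.eq_or_lt with rfl | hlt
  · rfl
  set Ca := 2 * (‖(_root_.hS c (_root_.hS c (v a))).toLp 2 volume‖ * M)
  set Cb := 2 * (‖(_root_.hS c (_root_.hS c (v b))).toLp 2 volume‖ * M)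
  have key : ∀ r, 0 < r → r ≤ b - a → |‖(_root_.hS c (v a)).toLp 2 volume‖ ^ 2 -
      ‖(_root_.hS c (v b)).toLp 2 volume‖ ^ 2| ≤ (Ca + Cb) * r := by
    intro r hr hrb
    have hcons := ((h.shift r).sub h).norm_eq_of_bdd (a := a) (b := b - r) (s := a) (t := b - r)
      (M := M + M) (fun t ht => by
        rw [map_sub, toLp_sub]
        exact (_root_.norm_sub_le _ _).trans (add_le_add
          (hM _ ⟨by linarith [ht.1], by linarith [ht.2]⟩)
          (hM _ ⟨by linarith [ht.1], by linarith [ht.2]⟩)))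
      ⟨le_refl _, by linarith⟩ ⟨by linarith, le_refl _⟩
    rw [toLp_sub, toLp_sub, sub_add_cancel] at hcons
    have h1 := h.abs_norm_sub_sq_sub_le hM (s := a) (t := a + r) ⟨le_refl _, hab⟩
      ⟨by linarith, by linarith⟩
    have h2 := h.abs_norm_sub_sq_sub_le hM (s := b) (t := b - r) ⟨hab, le_refl _⟩
      ⟨by linarith, by linarith⟩
    rw [norm_sub_rev, ← hcons] at h2
    have e1 : a + r - a = r := by ring
    have e2 : b - r - b = -r := by ring
    rw [e1, abs_of_pos hr] at h1
    rw [e2, abs_neg, abs_of_pos hr, neg_sq] at h2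
    have h3 := abs_le.1 h1
    have h4 := abs_le.1 h2
    have hr2 : 0 < r ^ 2 := by positivity
    rw [← mul_le_mul_iff_right₀ hr2, ← abs_of_pos hr2, ← abs_mul, abs_of_pos hr2, abs_le]
    simp only [Ca, Cb]
    constructor <;> nlinarith [h3.1, h3.2, h4.1, h4.2]
  have hlim : Filter.Tendsto (fun r => (Ca + Cb) * r) (nhdsWithin 0 (Set.Ioi 0)) (nhds 0) := by
    have : Continuous fun r : ℝ => (Ca + Cb) * r := by fun_prop
    simpa using (this.tendsto 0).mono_left nhdsWithin_le_nhds
  have hle := ge_of_tendsto hlim (b := |‖(_root_.hS c (v a)).toLp 2 volume‖ ^ 2 -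
      ‖(_root_.hS c (v b)).toLp 2 volume‖ ^ 2|) (by
    filter_upwards [Ioo_mem_nhdsGT (sub_pos.2 hlt)] with r hr using key r hr.1 hr.2.le)
  exact sub_eq_zero.1 (abs_nonpos_iff.1 hle)

theorem norm_hS_eq (h : OscSol c v) (s t : ℝ) :
    ‖(_root_.hS c (v s)).toLp 2 volume‖ ^ 2 = ‖(_root_.hS c (v t)).toLp 2 volume‖ ^ 2 := by
  refine eq_of_const_of_bddAbove (N := fun t => ‖(_root_.hS c (v t)).toLp 2 volume‖ ^ 2)
    (isClosed_norm_toLp_le h.hS.continuous) (fun a b M hab hM => ?_) s t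
  exact h.norm_hS_eq_of_bdd hab (M := √M) fun t ht => Real.le_sqrt_of_sq_le (hM t ht)

/-- Conservation of the `L²` norm. -/
theorem norm_eq (h : OscSol c v) (s t : ℝ) :
    ‖(v s).toLp 2 volume‖ ^ 2 = ‖(v t).toLp 2 volume‖ ^ 2 := by
  refine h.norm_eq_of_bdd (a := min s t) (b := max s t)
    (M := ‖(_root_.hS c (v 0)).toLp 2 volume‖) (fun r _ => ?_) ⟨min_le_left _ _, le_max_left _ _⟩
    ⟨min_le_right _ _, le_max_right _ _⟩
  exact ((sq_eq_sq₀ (norm_nonneg _) (norm_nonneg _)).1 (h.norm_hS_eq r 0)).le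

theorem exists_integral_norm_sq_le (h : OscSol c v) : ∃ C, ∀ t, ∫ x, ‖v t x‖ ^ 2 ≤ C :=
  ⟨‖(v 0).toLp 2 volume‖ ^ 2, fun t => by rw [← norm_toLp_sq, h.norm_eq t 0]⟩

end OscSol

theorem norm_pow_mul_norm_sq_succ (n : ℕ) (f : 𝓢(E2, ℂ)) (x : E2) :
    ‖x‖ ^ (2 * (n + 1)) * ‖f x‖ ^ 2 =
      ‖x‖ ^ (2 * n) * ‖xS 0 f x‖ ^ 2 + ‖x‖ ^ (2 * n) * ‖xS 1 f x‖ ^ 2 := by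
  simp only [xS_apply, norm_mul, norm_real, mul_pow, Real.norm_eq_abs, sq_abs]
  rw [mul_add, pow_add, mul_one, norm_sq_E2]
  ring

theorem integrable_norm_pow_mul_norm_sq (n : ℕ) (f : 𝓢(E2, ℂ)) :
    Integrable (fun x : E2 => ‖x‖ ^ (2 * n) * ‖f x‖ ^ 2) := by
  induction n generalizing f with
  | zero => simpa using integrable_norm_sq f
  | succ n ih =>
    simp only [norm_pow_mul_norm_sq_succ]
    exact (ih _).add (ih _)

theorem integral_norm_pow_mul_norm_sq_add_le (n : ℕ) (f g : 𝓢(E2, ℂ)) :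
    ∫ x : E2, ‖x‖ ^ (2 * n) * ‖f x‖ ^ 2 ≤
      (∫ x : E2, ‖x‖ ^ (2 * n) * ‖(f + g) x‖ ^ 2) + ∫ x : E2, ‖x‖ ^ (2 * n) * ‖(f - g) x‖ ^ 2 := by
  rw [← integral_add (integrable_norm_pow_mul_norm_sq n _) (integrable_norm_pow_mul_norm_sq n _)]
  refine integral_mono (integrable_norm_pow_mul_norm_sq n _)
    ((integrable_norm_pow_mul_norm_sq n _).add (integrable_norm_pow_mul_norm_sq n _)) fun x => ?_
  beta_reduce
  rw [← mul_add, add_apply, sub_apply]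
  have := parallelogram_law_with_norm ℝ (f x) (g x)
  gcongr
  nlinarith [sq_nonneg ‖f x‖, sq_nonneg ‖g x‖]

theorem OscSol.exists_integral_norm_pow_le (n : ℕ) {c : ℝ} {v : ℝ → 𝓢(E2, ℂ)} (h : OscSol c v) :
    ∃ C, ∀ t, ∫ x : E2, ‖x‖ ^ (2 * n) * ‖v t x‖ ^ 2 ≤ C := by
  induction n generalizing c v with
  | zero => simpa using h.exists_integral_norm_sq_le
  | succ n ih =>
    obtain ⟨C₁, h₁⟩ := ih (h.lower 0)
    obtain ⟨C₂, h₂⟩ := ih (h.raise 0)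
    obtain ⟨C₃, h₃⟩ := ih (h.lower 1)
    obtain ⟨C₄, h₄⟩ := ih (h.raise 1)
    refine ⟨C₁ + C₂ + (C₃ + C₄), fun t => ?_⟩
    simp only [norm_pow_mul_norm_sq_succ]
    rw [integral_add (integrable_norm_pow_mul_norm_sq n _) (integrable_norm_pow_mul_norm_sq n _)]
    exact add_le_add
      ((integral_norm_pow_mul_norm_sq_add_le n _ _).trans (add_le_add (h₁ t) (h₂ t)))
      ((integral_norm_pow_mul_norm_sq_add_le n _ _).trans (add_le_add (h₃ t) (h₄ t)))

/-- A continuous weight of at most polynomial growth. -/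
def IsPolyWeight (ρ : E2 → ℝ) : Prop :=
  Continuous ρ ∧ ∃ (C : ℝ) (d : ℕ), ∀ x, ‖ρ x‖ ≤ C * (1 + ‖x‖) ^ d

theorem IsPolyWeight.exists_sq_le {ρ : E2 → ℝ} (hρ : IsPolyWeight ρ) :
    ∃ (C : ℝ) (d : ℕ), 0 ≤ C ∧ ∀ x, ρ x ^ 2 ≤ C * (1 + ‖x‖ ^ (2 * d)) := by
  obtain ⟨-, C, d, h⟩ := hρ
  refine ⟨C ^ 2 * 2 ^ (2 * d - 1), d, by positivity, fun x => ?_⟩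
  have h1 := add_pow_le (zero_le_one' ℝ) (norm_nonneg x) (2 * d)
  rw [one_pow] at h1
  calc ρ x ^ 2 = ‖ρ x‖ ^ 2 := by simp
    _ ≤ (C * (1 + ‖x‖) ^ d) ^ 2 := by gcongr; exact h x
    _ = C ^ 2 * (1 + ‖x‖) ^ (2 * d) := by ring
    _ ≤ C ^ 2 * (2 ^ (2 * d - 1) * (1 + ‖x‖ ^ (2 * d))) := by gcongr
    _ = _ := by ring

theorem IsPolyWeight.exists_mul_le {ρ : E2 → ℝ} (hρ : IsPolyWeight ρ) :
    ∃ (C : ℝ) (d : ℕ), 0 ≤ C ∧ ∀ (f g : 𝓢(E2, ℂ)) (x : E2),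
      ‖ρ x * (f x * (starRingEnd ℂ) (g x))‖ ≤
        C * (‖f x‖ ^ 2 + ‖x‖ ^ (2 * d) * ‖f x‖ ^ 2) + ‖g x‖ ^ 2 := by
  obtain ⟨C, d, hC, h⟩ := hρ.exists_sq_le
  refine ⟨C, d, hC, fun f g x => ?_⟩
  simp only [norm_mul, norm_real, RCLike.norm_conj, Real.norm_eq_abs]
  have h1 := mul_le_mul_of_nonneg_right (h x) (sq_nonneg ‖f x‖)
  rw [← sq_abs] at h1
  nlinarith [sq_nonneg (|ρ x| * ‖f x‖ - ‖g x‖), sq_nonneg (|ρ x| * ‖f x‖), sq_nonneg ‖g x‖]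

theorem IsPolyWeight.integrable {ρ : E2 → ℝ} (hρ : IsPolyWeight ρ) (f g : 𝓢(E2, ℂ)) :
    Integrable (fun x => ρ x * (f x * (starRingEnd ℂ) (g x))) := by
  obtain ⟨C, d, -, h⟩ := hρ.exists_mul_le
  refine Integrable.mono' ((((integrable_norm_sq f).add
    (integrable_norm_pow_mul_norm_sq d f)).const_mul C).add (integrable_norm_sq g)) ?_
    (Filter.Eventually.of_forall (h f g))
  have h1 := hρ.1
  have h2 := f.continuous
  have h3 := g.continuous
  exact Continuous.aestronglyMeasurable (by fun_prop)

theorem IsPolyWeight.exists_integral_le {ρ : E2 → ℝ} (hρ : IsPolyWeight ρ) {a b : ℝ}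
    {u v : ℝ → 𝓢(E2, ℂ)} (hu : OscSol a u) (hv : OscSol b v) :
    ∃ C, ∀ t, ∫ x, ‖ρ x * (u t x * (starRingEnd ℂ) (v t x))‖ ≤ C := by
  obtain ⟨C, d, hC, h⟩ := hρ.exists_mul_le
  obtain ⟨C₁, h₁⟩ := hu.exists_integral_norm_sq_le
  obtain ⟨C₂, h₂⟩ := hu.exists_integral_norm_pow_le d
  obtain ⟨C₃, h₃⟩ := hv.exists_integral_norm_sq_le
  refine ⟨C * (C₁ + C₂) + C₃, fun t => ?_⟩
  have i₁ := integrable_norm_sq (u t)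
  have i₂ := integrable_norm_pow_mul_norm_sq d (u t)
  have i₃ := integrable_norm_sq (v t)
  refine (integral_mono (hρ.integrable _ _).norm (((i₁.add i₂).const_mul C).add i₃)
    (h (u t) (v t))).trans ?_
  have i₄ : Integrable (fun x => C * (‖u t x‖ ^ 2 + ‖x‖ ^ (2 * d) * ‖u t x‖ ^ 2)) :=
    (i₁.add i₂).const_mul C
  have e : ∫ x, (C * (‖u t x‖ ^ 2 + ‖x‖ ^ (2 * d) * ‖u t x‖ ^ 2) + ‖v t x‖ ^ 2) =
      C * ((∫ x, ‖u t x‖ ^ 2) + ∫ x, ‖x‖ ^ (2 * d) * ‖u t x‖ ^ 2) + ∫ x, ‖v t x‖ ^ 2 := by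
    rw [integral_add i₄ i₃, integral_const_mul, integral_add i₁ i₂]
  refine e.le.trans ?_
  gcongr
  exacts [h₁ t, h₂ t, h₃ t]

/-- The weighted pointwise product `ρ f conj(g)`. -/
def weightedPair (ρ : E2 → ℝ) (f g : 𝓢(E2, ℂ)) (x : E2) : ℂ :=
  ρ x * (f x * (starRingEnd ℂ) (g x))

theorem hasDerivAt_weightedPair (ρ : E2 → ℝ) {a b : ℝ} {u v : ℝ → 𝓢(E2, ℂ)} (hu : OscSol a u)
    (hv : OscSol b v) (t : ℝ) (x : E2) :
    HasDerivAt (fun s => weightedPair ρ (u s) (v s) x)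
      (I * (weightedPair ρ (hS a (u t)) (v t) x - weightedPair ρ (u t) (hS b (v t)) x)) t := by
  refine (((hu.2 t x).mul (Complex.conjCLE.hasFDerivAt.comp_hasDerivAt t
    (hv.2 t x))).const_mul (ρ x : ℂ)).congr_deriv ?_
  simp only [smul_apply, smul_eq_mul, weightedPair, Function.comp_apply,
    ContinuousLinearEquiv.coe_coe, Complex.conjCLE_apply, map_mul, conj_I]
  ring

theorem integrable_I_mul_sub {f g : E2 → ℂ} (hf : Integrable f) (hg : Integrable g) :
    Integrable fun x => I * (f x - g x) :=
  (hf.sub hg).const_mul I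

theorem exists_integral_norm_I_mul_sub_le {f g : ℝ → E2 → ℂ} (hf : ∀ t, Integrable (f t))
    (hg : ∀ t, Integrable (g t)) (hf' : ∃ C, ∀ t, ∫ x, ‖f t x‖ ≤ C)
    (hg' : ∃ C, ∀ t, ∫ x, ‖g t x‖ ≤ C) :
    ∃ C, ∀ t, ∫ x, ‖I * (f t x - g t x)‖ ≤ C := by
  obtain ⟨C, hC⟩ := hf'
  obtain ⟨D, hD⟩ := hg'
  refine ⟨C + D, fun t => ?_⟩
  refine (integral_mono (integrable_I_mul_sub (hf t) (hg t)).norm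
    ((hf t).norm.add (hg t).norm) fun x => ?_).trans
    ((integral_add (hf t).norm (hg t).norm).le.trans (add_le_add (hC t) (hD t)))
  rw [norm_mul, norm_I, one_mul]
  exact norm_sub_le _ _

namespace IsPolyWeight

variable {ρ : E2 → ℝ} {a b : ℝ} {u v : ℝ → 𝓢(E2, ℂ)}

theorem continuous_weightedPair (hρ : IsPolyWeight ρ) (hu : OscSol a u) (hv : OscSol b v) :
    Continuous fun p : ℝ × E2 => weightedPair ρ (u p.1) (v p.1) p.2 :=
  (Complex.continuous_ofReal.comp (hρ.1.comp continuous_snd)).mul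
    (hu.continuous.mul (Complex.continuous_conj.comp hv.continuous))

theorem integrable_weightedPair (hρ : IsPolyWeight ρ) (f g : 𝓢(E2, ℂ)) :
    Integrable (weightedPair ρ f g) :=
  hρ.integrable f g

theorem exists_integral_weightedPair_le (hρ : IsPolyWeight ρ) (hu : OscSol a u)
    (hv : OscSol b v) : ∃ C, ∀ t, ∫ x, ‖weightedPair ρ (u t) (v t) x‖ ≤ C :=
  hρ.exists_integral_le hu hv

theorem hasDerivAt_integral (hρ : IsPolyWeight ρ) (hu : OscSol a u) (hv : OscSol b v) (t : ℝ) :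
    HasDerivAt (fun t => ∫ x, weightedPair ρ (u t) (v t) x)
      (I * ((∫ x, weightedPair ρ (hS a (u t)) (v t) x) -
        ∫ x, weightedPair ρ (u t) (hS b (v t)) x)) t := by
  have hi := fun f g => hρ.integrable_weightedPair f g
  obtain ⟨C₁, hC₁⟩ := exists_integral_norm_I_mul_sub_le (fun t => hi (hS a (u t)) (v t))
    (fun t => hi (u t) (hS b (v t))) (hρ.exists_integral_weightedPair_le hu.hS hv)
    (hρ.exists_integral_weightedPair_le hu hv.hS)
  have hb₂ := exists_integral_norm_I_mul_sub_le (fun t => hi (hS a (hS a (u t))) (v t))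
    (fun t => hi (hS a (u t)) (hS b (v t))) (hρ.exists_integral_weightedPair_le hu.hS.hS hv)
    (hρ.exists_integral_weightedPair_le hu.hS hv.hS)
  have hb₃ := exists_integral_norm_I_mul_sub_le (fun t => hi (hS a (u t)) (hS b (v t)))
    (fun t => hi (u t) (hS b (hS b (v t)))) (hρ.exists_integral_weightedPair_le hu.hS hv.hS)
    (hρ.exists_integral_weightedPair_le hu hv.hS.hS)
  have hi₂ := fun t => integrable_I_mul_sub (hi (hS a (hS a (u t))) (v t))
    (hi (hS a (u t)) (hS b (v t)))
  have hi₃ := fun t => integrable_I_mul_sub (hi (hS a (u t)) (hS b (v t)))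
    (hi (u t) (hS b (hS b (v t))))
  obtain ⟨C₂, hC₂⟩ := exists_integral_norm_I_mul_sub_le hi₂ hi₃ hb₂ hb₃
  have hc₁ := hρ.continuous_weightedPair hu.hS hv
  have hc₂ := hρ.continuous_weightedPair hu hv.hS
  have hc₃ := hρ.continuous_weightedPair hu.hS.hS hv
  have hc₄ := hρ.continuous_weightedPair hu.hS hv.hS
  have hc₅ := hρ.continuous_weightedPair hu hv.hS.hS
  refine (hasDerivAt_integral_of_bdd (hasDerivAt_weightedPair ρ hu hv)
    (fun t x => ((hasDerivAt_weightedPair ρ hu.hS hv t x).sub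
      (hasDerivAt_weightedPair ρ hu hv.hS t x)).const_mul I)
    (continuous_const.mul (hc₁.sub hc₂))
    (continuous_const.mul ((continuous_const.mul (hc₃.sub hc₄)).sub
      (continuous_const.mul (hc₄.sub hc₅))))
    (fun t => hi (u t) (v t))
    (fun t => integrable_I_mul_sub (hi (hS a (u t)) (v t)) (hi (u t) (hS b (v t))))
    (fun t => integrable_I_mul_sub (hi₂ t) (hi₃ t)) hC₁ hC₂ t).congr_deriv ?_
  rw [integral_const_mul, integral_sub (hi (hS a (u t)) (v t)) (hi (u t) (hS b (v t)))]

theorem deriv_deriv_integral (hρ : IsPolyWeight ρ) (hu : OscSol a u) (t : ℝ) :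
    deriv (deriv fun t => ∫ x, weightedPair ρ (u t) (u t) x) t =
      2 * (∫ x, weightedPair ρ (hS a (u t)) (hS a (u t)) x) -
        (∫ x, weightedPair ρ (hS a (hS a (u t))) (u t) x) -
        ∫ x, weightedPair ρ (u t) (hS a (hS a (u t))) x := by
  have h := ((hρ.hasDerivAt_integral hu.hS hu t).fun_sub
    (hρ.hasDerivAt_integral hu hu.hS t)).const_mul I
  rw [funext fun t => (hρ.hasDerivAt_integral hu hu t).deriv, h.deriv]
  linear_combination ((∫ x, weightedPair ρ (hS a (hS a (u t))) (u t) x) -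
    2 * (∫ x, weightedPair ρ (hS a (u t)) (hS a (u t)) x) +
    ∫ x, weightedPair ρ (u t) (hS a (hS a (u t))) x) * I_sq

end IsPolyWeight

theorem _root_.Function.HasTemperateGrowth.pdR {m : E2 → ℝ} (hm : m.HasTemperateGrowth)
    (k : Fin 2) : (pdR k m).HasTemperateGrowth := by
  have h : (fderiv ℝ m).HasTemperateGrowth := by
    refine ⟨hm.1.fderiv_right (by simp), fun n => ?_⟩
    obtain ⟨d, C, h⟩ := hm.2 (n + 1)
    exact ⟨d, C, fun x => norm_iteratedFDeriv_fderiv (𝕜 := ℝ) (f := m) (n := n) ▸ h x⟩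
  exact (ContinuousLinearMap.apply ℝ ℝ
    (EuclideanSpace.single k (1 : ℝ) : E2)).hasTemperateGrowth.comp h

/-- Smooth real functions on the plane all of whose derivatives grow at most polynomially. -/
abbrev TemperateWeight : Type := {m : E2 → ℝ // m.HasTemperateGrowth}

namespace TemperateWeight

/-- The partial derivative of a temperate weight. -/
def D (k : Fin 2) (m : TemperateWeight) : TemperateWeight := ⟨pdR k m.1, m.2.pdR k⟩

/-- Multiplication of Schwartz functions by a temperate weight. -/
def mulS (m : TemperateWeight) : 𝓢(E2, ℂ) →L[ℂ] 𝓢(E2, ℂ) :=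
  SchwartzMap.smulLeftCLM ℂ (fun x : E2 => ((m.1 x : ℝ) : ℂ))

variable (m : TemperateWeight)

theorem mulS_apply (f : 𝓢(E2, ℂ)) (x : E2) : m.mulS f x = (m.1 x : ℂ) * f x := by
  have h : Function.HasTemperateGrowth fun x : E2 => ((m.1 x : ℝ) : ℂ) :=
    Complex.ofRealCLM.hasTemperateGrowth.comp m.2
  simp [mulS, SchwartzMap.smulLeftCLM_apply_apply h]

theorem D_comm (k l : Fin 2) : D k (D l m) = D l (D k m) := by
  refine Subtype.ext (funext fun x => ?_)
  change fderiv ℝ (fun y => fderiv ℝ m.1 y (EuclideanSpace.single l 1)) x _ =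
    fderiv ℝ (fun y => fderiv ℝ m.1 y (EuclideanSpace.single k 1)) x _
  have h2 : DifferentiableAt ℝ (fderiv ℝ m.1) x :=
    (m.2.1.fderiv_right (m := 1) (by norm_cast)).differentiable one_ne_zero x
  have hs := m.2.1.contDiffAt.isSymmSndFDerivAt (x := x) (by simp; norm_cast)
  rw [fderiv_clm_apply h2 (by fun_prop), fderiv_clm_apply h2 (by fun_prop)]
  simpa using hs.eq _ _

theorem dS_mulS (k : Fin 2) (f : 𝓢(E2, ℂ)) :
    dS k (m.mulS f) = (m.D k).mulS f + m.mulS (dS k f) := by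
  ext x
  have hx : (m.mulS f : E2 → ℂ) = (fun y => (m.1 y : ℂ)) * ⇑f := funext (m.mulS_apply f)
  have h1 : HasFDerivAt (fun y : E2 => ((m.1 y : ℝ) : ℂ)) (Complex.ofRealCLM ∘L fderiv ℝ m.1 x) x :=
    Complex.ofRealCLM.hasFDerivAt.comp x (m.2.1.differentiable (by simp) x).hasFDerivAt
  rw [add_apply, mulS_apply, mulS_apply, dS_apply, dS_apply, pd, pd, hx,
    (h1.mul (f.hasFDerivAt x)).fderiv]
  simp [D, _root_.pdR]
  ring

theorem mulS_xS (k : Fin 2) (f : 𝓢(E2, ℂ)) : m.mulS (xS k f) = xS k (m.mulS f) := by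
  ext x
  simp only [xS_apply, mulS_apply]
  ring

theorem inner_mulS (f g : 𝓢(E2, ℂ)) :
    inner ℂ ((m.mulS f).toLp 2) (g.toLp 2) = inner ℂ (f.toLp 2) ((m.mulS g).toLp 2) := by
  rw [inner_toLp, inner_toLp]
  congr 1; ext x
  simp only [mulS_apply, map_mul, Complex.conj_ofReal]
  ring

/-- The commutator `[m, -Δ] = Δm + 2 ∇m · ∇`. -/
def commS (f : 𝓢(E2, ℂ)) : 𝓢(E2, ℂ) :=
  ((m.D 0).D 0).mulS f + ((m.D 1).D 1).mulS f +
    (2 : ℂ) • ((m.D 0).mulS (dS 0 f) + (m.D 1).mulS (dS 1 f))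

theorem hS_mulS (c : ℝ) (f : 𝓢(E2, ℂ)) :
    hS c (m.mulS f) = m.mulS (hS c f) - m.commS f := by
  simp only [hS_eq, commS, dS_mulS, map_add, map_sub, map_smul, mulS_xS]
  module

theorem inner_commS (f g : 𝓢(E2, ℂ)) :
    inner ℂ ((m.commS f).toLp 2) (g.toLp 2) = -inner ℂ (f.toLp 2) ((m.commS g).toLp 2) := by
  have h2 : (starRingEnd ℂ) (2 : ℂ) = 2 := map_ofNat _ 2
  simp only [commS, ← SchwartzMap.toLpCLM_apply (𝕜 := ℂ), map_add, map_smul,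
    inner_add_left, inner_add_right, inner_smul_left, inner_smul_right, h2]
  simp only [SchwartzMap.toLpCLM_apply, inner_dS, inner_mulS, dS_mulS]
  simp only [← SchwartzMap.toLpCLM_apply (𝕜 := ℂ), map_add, inner_add_right]
  ring

theorem hS_commS (c : ℝ) (f : 𝓢(E2, ℂ)) :
    hS c (m.commS f) - m.commS (hS c f) =
      -((4 : ℂ) • (dS 0 (((m.D 0).D 0).mulS (dS 0 f)) + dS 0 (((m.D 1).D 0).mulS (dS 1 f)) +
          (dS 1 (((m.D 0).D 1).mulS (dS 0 f)) + dS 1 (((m.D 1).D 1).mulS (dS 1 f)))) +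
        ((((m.D 0).D 0).D 0).D 0).mulS f + ((((m.D 0).D 0).D 1).D 1).mulS f +
        (((((m.D 1).D 1).D 0).D 0).mulS f + ((((m.D 1).D 1).D 1).D 1).mulS f) +
        (4 : ℂ) • (xS 0 ((m.D 0).mulS f) + xS 1 ((m.D 1).mulS f))) := by
  simp only [hS_eq, commS, dS_mulS, map_add, map_sub, map_smul, mulS_xS, dS_xS, D_comm _ 1 0,
    dS_comm 1 0]
  simp [mulS_xS]
  module

theorem integral_weightedPair (f g : 𝓢(E2, ℂ)) :
    ∫ x, weightedPair m.1 f g x = inner ℂ (g.toLp 2) ((m.mulS f).toLp 2) := by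
  rw [inner_toLp]
  congr 1; ext x
  rw [weightedPair, mulS_apply]
  ring

theorem inner_mulS_hS_hS (f : 𝓢(E2, ℂ)) (c : ℝ) :
    2 * inner ℂ ((hS c f).toLp 2) ((m.mulS (hS c f)).toLp 2) -
        inner ℂ (f.toLp 2) ((m.mulS (hS c (hS c f))).toLp 2) -
        inner ℂ ((hS c (hS c f)).toLp 2) ((m.mulS f).toLp 2) =
      inner ℂ (f.toLp 2) ((hS c (m.commS f) - m.commS (hS c f)).toLp 2) := by
  have h1 : inner ℂ (f.toLp 2) ((m.mulS (hS c (hS c f))).toLp 2) =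
      inner ℂ ((hS c (m.mulS f)).toLp 2) ((hS c f).toLp 2) := by
    rw [inner_hS, inner_mulS]
  rw [inner_hS c (hS c f) (m.mulS f), h1, hS_mulS]
  simp only [← SchwartzMap.toLpCLM_apply (𝕜 := ℂ), map_sub, inner_sub_left, inner_sub_right]
  simp only [SchwartzMap.toLpCLM_apply]
  rw [inner_commS m f (hS c f), inner_mulS m (hS c f) (hS c f), inner_hS c f (m.commS f)]
  ring

theorem inner_mulS_D_D (k : Fin 2) (f : 𝓢(E2, ℂ)) :
    inner ℂ (f.toLp 2) (((D k (D k m)).mulS f).toLp 2) =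
      inner ℂ (f.toLp 2) ((m.mulS (dS k (dS k f))).toLp 2) +
        inner ℂ ((dS k (dS k f)).toLp 2) ((m.mulS f).toLp 2) +
        2 * inner ℂ ((dS k f).toLp 2) ((m.mulS (dS k f)).toLp 2) := by
  have h2 : (starRingEnd ℂ) (2 : ℂ) = 2 := map_ofNat _ 2
  simp only [inner_dS, dS_mulS, map_add]
  simp only [← SchwartzMap.toLpCLM_apply (𝕜 := ℂ), map_add, inner_add_right]
  ring

theorem virial_integral (f : 𝓢(E2, ℂ)) (c : ℝ) :
    2 * (∫ x, weightedPair m.1 (hS c f) (hS c f) x) -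
        (∫ x, weightedPair m.1 (hS c (hS c f)) f x) -
        ∫ x, weightedPair m.1 f (hS c (hS c f)) x =
      4 * (∑ k, ∑ l, ∫ x, weightedPair (D k (D l m)).1 (dS k f) (dS l f) x) -
        (∑ j, ∑ k, ((∫ x, weightedPair (D j (D j m)).1 (dS k (dS k f)) f x) +
          (∫ x, weightedPair (D j (D j m)).1 f (dS k (dS k f)) x) +
          2 * ∫ x, weightedPair (D j (D j m)).1 (dS k f) (dS k f) x)) -
        4 * ∑ k, ∫ x, weightedPair (D k m).1 (xS k f) f x := by
  have hd : ∀ k g, inner ℂ (f.toLp 2) ((dS k g).toLp 2) =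
      -inner ℂ ((dS k f).toLp 2) (g.toLp 2) := fun k g => by rw [inner_dS, neg_neg]
  simp only [integral_weightedPair, inner_mulS_hS_hS, hS_commS, ← inner_mulS_D_D]
  simp only [Fin.sum_univ_two, ← SchwartzMap.toLpCLM_apply (𝕜 := ℂ), map_add, map_neg, map_smul,
    inner_add_right, inner_neg_right, inner_smul_right, mulS_xS]
  simp only [SchwartzMap.toLpCLM_apply, D_comm _ 1 0, hd]
  ring

end TemperateWeight

theorem differentiableAt_ofReal_iff {E : Type*} [NormedAddCommGroup E] [NormedSpace ℝ E]
    {h : E → ℝ} {x : E} :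
    DifferentiableAt ℝ (fun y => (h y : ℂ)) x ↔ DifferentiableAt ℝ h x :=
  ⟨fun H => by simpa [Function.comp_def] using Complex.reCLM.differentiableAt.comp x H,
    fun H => Complex.ofRealCLM.differentiableAt.comp x H⟩

theorem fderiv_ofReal_apply {E : Type*} [NormedAddCommGroup E] [NormedSpace ℝ E]
    (h : E → ℝ) (x v : E) : fderiv ℝ (fun y => (h y : ℂ)) x v = (fderiv ℝ h x v : ℂ) := by
  by_cases H : DifferentiableAt ℝ h x
  · have := (Complex.ofRealCLM.hasFDerivAt.comp x H.hasFDerivAt).fderiv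
    simpa [Function.comp_def] using congrArg (· v) this
  · rw [fderiv_zero_of_not_differentiableAt H,
      fderiv_zero_of_not_differentiableAt (mt differentiableAt_ofReal_iff.mp H)]
    simp

theorem deriv_ofReal (h : ℝ → ℝ) : deriv (fun s => (h s : ℂ)) =
    fun s => ((deriv h s : ℝ) : ℂ) :=
  funext fun s => fderiv_ofReal_apply h s 1

theorem pd_ofReal (k : Fin 2) (h : E2 → ℝ) :
    pd k (fun y => (h y : ℂ)) = fun y => (pdR k h y : ℂ) :=
  funext fun x => fderiv_ofReal_apply h x _

theorem hasFDerivAt_conj (g : 𝓢(E2, ℂ)) (x : E2) :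
    HasFDerivAt (fun y => (starRingEnd ℂ) (g y))
      ((Complex.conjCLE : ℂ →L[ℝ] ℂ) ∘L fderiv ℝ g x) x :=
  Complex.conjCLE.hasFDerivAt.comp x (g.hasFDerivAt x)

theorem pd_conj (k : Fin 2) (g : 𝓢(E2, ℂ)) (x : E2) :
    pd k (fun y => (starRingEnd ℂ) (g y)) x = (starRingEnd ℂ) (dS k g x) := by
  rw [pd, (hasFDerivAt_conj g x).fderiv, dS_apply]
  rfl

theorem differentiable_mul_conj (f g : 𝓢(E2, ℂ)) :
    Differentiable ℝ fun y => f y * (starRingEnd ℂ) (g y) :=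
  fun x => ((f.hasFDerivAt x).mul (hasFDerivAt_conj g x)).differentiableAt

theorem pd_mul_conj (k : Fin 2) (f g : 𝓢(E2, ℂ)) :
    pd k (fun y => f y * (starRingEnd ℂ) (g y)) =
      fun y => dS k f y * (starRingEnd ℂ) (g y) + f y * (starRingEnd ℂ) (dS k g y) := by
  funext x
  change fderiv ℝ (⇑f * fun y => (starRingEnd ℂ) (g y)) x _ = _
  rw [((f.hasFDerivAt x).mul (hasFDerivAt_conj g x)).fderiv, dS_apply, dS_apply]
  simp [pd]
  ring

theorem lapR_norm_sq (f : 𝓢(E2, ℂ)) (x : E2) :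
    ((lapR (fun y => ‖f y‖ ^ 2) x : ℝ) : ℂ) =
      ∑ k, (dS k (dS k f) x * (starRingEnd ℂ) (f x) + f x * (starRingEnd ℂ) (dS k (dS k f) x) +
        2 * (dS k f x * (starRingEnd ℂ) (dS k f x))) := by
  have hf : (fun y => ((‖f y‖ ^ 2 : ℝ) : ℂ)) = fun y => f y * (starRingEnd ℂ) (f y) :=
    funext fun y => by rw [Complex.mul_conj', Complex.ofReal_pow]
  rw [lapR, Complex.ofReal_sum]
  refine Finset.sum_congr rfl fun k _ => ?_
  rw [← congrFun (pd_ofReal k _) x, ← pd_ofReal k, hf, pd_mul_conj]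
  have h1 := congrFun (pd_mul_conj k (dS k f) f) x
  have h2 := congrFun (pd_mul_conj k f (dS k f)) x
  simp only [pd] at h1 h2 ⊢
  rw [fderiv_fun_add (differentiable_mul_conj _ _ x) (differentiable_mul_conj _ _ x), add_apply,
    h1, h2]
  ring

theorem hasTemperateGrowth_of_bound {ρ : E2 → ℝ} (hρ : ContDiff ℝ (⊤ : ℕ∞) ρ)
    (hgrowth : ∀ n : ℕ, ∃ (C : ℝ) (d : ℕ), ∀ x : E2,
      ‖iteratedFDeriv ℝ n ρ x‖ ≤ C * (1 + ‖x‖) ^ d) : ρ.HasTemperateGrowth :=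
  ⟨hρ, fun n => let ⟨C, d, h⟩ := hgrowth n; ⟨d, C, h⟩⟩

theorem TemperateWeight.isPolyWeight (m : TemperateWeight) : IsPolyWeight m.1 := by
  obtain ⟨d, C, h⟩ := m.2.2 0
  exact ⟨m.2.1.continuous, C, d, fun x => by simpa [norm_iteratedFDeriv_zero] using h x⟩

namespace TemperateWeight

variable (m : TemperateWeight) (f : 𝓢(E2, ℂ))

theorem integral_hessian :
    ∫ x, (∑ k : Fin 2, ∑ l : Fin 2, (pdR k (pdR l m.1) x : ℂ) * pd k (fun y => f y) x
        * pd l (fun y => (starRingEnd ℂ) (f y)) x) =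
      ∑ k, ∑ l, ∫ x, weightedPair (D k (D l m)).1 (dS k f) (dS l f) x := by
  have hi := fun k l => (D k (D l m)).isPolyWeight.integrable_weightedPair (dS k f) (dS l f)
  simp_rw [← integral_finsetSum Finset.univ fun l _ => hi _ l]
  rw [← integral_finsetSum _ fun k _ => integrable_finsetSum _ fun l _ => hi k l]
  refine integral_congr_ae (.of_forall fun x => Finset.sum_congr rfl fun k _ =>
    Finset.sum_congr rfl fun l _ => ?_)
  simp only [weightedPair, pd_conj, dS_apply k f]
  exact mul_assoc _ _ _

theorem integral_lapR_mul_lapR :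
    ((∫ x, lapR m.1 x * lapR (fun y => ‖f y‖ ^ 2) x : ℝ) : ℂ) =
      ∑ j, ∑ k, ((∫ x, weightedPair (D j (D j m)).1 (dS k (dS k f)) f x) +
        (∫ x, weightedPair (D j (D j m)).1 f (dS k (dS k f)) x) +
        2 * ∫ x, weightedPair (D j (D j m)).1 (dS k f) (dS k f) x) := by
  have hi := fun j => (D j (D j m)).isPolyWeight.integrable_weightedPair
  have hs : ∀ j k, (∫ x, weightedPair (D j (D j m)).1 (dS k (dS k f)) f x) +
        (∫ x, weightedPair (D j (D j m)).1 f (dS k (dS k f)) x) +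
        2 * (∫ x, weightedPair (D j (D j m)).1 (dS k f) (dS k f) x) =
      ∫ x, (weightedPair (D j (D j m)).1 (dS k (dS k f)) f x +
        weightedPair (D j (D j m)).1 f (dS k (dS k f)) x +
        2 * weightedPair (D j (D j m)).1 (dS k f) (dS k f) x) := fun j k => by
    rw [integral_add ((hi j _ _).fun_add (hi j _ _)) ((hi j _ _).const_mul 2),
      integral_add (hi j _ _) (hi j _ _), integral_const_mul]
  have hI := fun j k => ((hi j (dS k (dS k f)) f).fun_add (hi j f (dS k (dS k f)))).fun_add
    ((hi j (dS k f) (dS k f)).const_mul 2)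
  simp only [hs]
  simp_rw [← integral_finsetSum Finset.univ fun k _ => hI _ k]
  rw [← integral_finsetSum _ fun j _ => integrable_finsetSum _ fun k _ => hI j k,
    ← integral_complex_ofReal]
  refine integral_congr_ae (.of_forall fun x => ?_)
  simp only [Complex.ofReal_mul, lapR_norm_sq]
  rw [lapR, Complex.ofReal_sum, Finset.sum_mul]
  refine Finset.sum_congr rfl fun j _ => ?_
  rw [Finset.mul_sum]
  refine Finset.sum_congr rfl fun k _ => ?_
  simp only [weightedPair, D]
  ring

theorem integral_radial :
    ((∫ x : E2, (∑ k : Fin 2, x k * pdR k m.1 x) * ‖f x‖ ^ 2 : ℝ) : ℂ) =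
      ∑ k, ∫ x, weightedPair (D k m).1 (xS k f) f x := by
  rw [← integral_finsetSum _ fun k _ =>
    (D k m).isPolyWeight.integrable_weightedPair (xS k f) f, ← integral_complex_ofReal]
  refine integral_congr_ae (.of_forall fun x => ?_)
  simp only [Complex.ofReal_mul, Complex.ofReal_sum, Complex.ofReal_pow, Finset.sum_mul]
  refine Finset.sum_congr rfl fun k _ => ?_
  simp only [weightedPair, D, xS_apply]
  rw [mul_assoc (x k : ℂ) (f x), Complex.mul_conj']
  ring

theorem integral_mul_norm_sq :
    ((∫ x, m.1 x * ‖f x‖ ^ 2 : ℝ) : ℂ) = ∫ x, weightedPair m.1 f f x := by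
  rw [← integral_complex_ofReal]
  refine integral_congr_ae (.of_forall fun x => ?_)
  simp only [Complex.ofReal_mul, weightedPair, Complex.mul_conj', Complex.ofReal_pow]

end TemperateWeight

/-- The second virial identity: for a Schwartz-regular solution of the linear Schrödinger
equation with harmonic potential and a smooth weight `ρ` with polynomially growing
derivatives,
`d²/dt² ∫ ρ|w|² = 4∫ Σ_{k,l} ∂²_{kl}ρ ∂ₖw ∂ₗconj(w) − ∫ Δρ Δ(|w|²) − 4∫ (x·∇ρ)|w|²`. -/
theorem second_virial_identity (w : ℝ → SchwartzMap E2 ℂ) (hw : IsLinSolution w)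
    (ρ : E2 → ℝ) (hρ : ContDiff ℝ (⊤ : ℕ∞) ρ)
    (hgrowth : ∀ n : ℕ, ∃ (C : ℝ) (d : ℕ), ∀ x : E2,
      ‖iteratedFDeriv ℝ n ρ x‖ ≤ C * (1 + ‖x‖)^d)
    (t : ℝ) :
    deriv (deriv (fun τ => ∫ x : E2, ρ x * ‖w τ x‖^2)) t
      = 4 * (∫ x : E2, (∑ k : Fin 2, ∑ l : Fin 2,
            (pdR k (pdR l ρ) x : ℂ) * pd k (fun y => w t y) x
              * pd l (fun y => (starRingEnd ℂ) (w t y)) x)).re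
        - (∫ x : E2, lapR ρ x * lapR (fun y => ‖w t y‖^2) x)
        - 4 * ∫ x : E2, (∑ k : Fin 2, x k * pdR k ρ x) * ‖w t x‖^2 := by

  let m : TemperateWeight := ⟨ρ, hasTemperateGrowth_of_bound hρ hgrowth⟩
  have h1 := deriv_ofReal fun τ => ∫ x : E2, ρ x * ‖w τ x‖ ^ 2
  have h2 := congrFun (deriv_ofReal (deriv fun τ => ∫ x : E2, ρ x * ‖w τ x‖ ^ 2)) t
  have h3 := (m.isPolyWeight.deriv_deriv_integral hw.oscSol t).trans (m.virial_integral (w t) 0)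
  rw [← h1, funext fun τ => m.integral_mul_norm_sq (w τ), h3, ← m.integral_hessian,
    ← m.integral_lapR_mul_lapR, ← m.integral_radial] at h2
  simpa using (congrArg Complex.re h2).symm
end
end
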